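/- arXiv:1708.02819 — 2 statements merged into one kernel-verified Lean document; each statement's English description precedes it below -/
import Mathlib

section
/- Let τ ∈ ℂ with Im τ > 0, let σ be the Weierstraß σ-function of the lattice Ω = {m + nτ : m,n ∈ ℤ}, and suppose η₁ ≠ 0 and Re(1/η₁) ≥ (Im τ)/(2π). Then area(J(σ) ∩ A(σ)) > 0. -/
open MeasureTheory Filter Metric Set Topology ENNReal

/-- Logarithmic area of a subset of the plane. -/
noncomputable def logArea (A : Set ℂ) : ℝ≥0∞ :=
  ∫⁻ z in A, ENNReal.ofReal ((‖z‖ ^ 2)⁻¹)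

/-- The set Δ = {z : |z| ≥ 1}. -/
def Delta : Set ℂ := {z : ℂ | 1 ≤ ‖z‖}

/-- Chordal (spherical) distance on the Riemann sphere ℂ ∪ {∞}, with ∞ encoded as `none`. -/
noncomputable def chordalDist : Option ℂ → Option ℂ → ℝ
  | none, none => 0
  | none, some w => 2 / Real.sqrt (1 + ‖w‖ ^ 2)
  | some z, none => 2 / Real.sqrt (1 + ‖z‖ ^ 2)
  | some z, some w =>
      2 * ‖z - w‖ / (Real.sqrt (1 + ‖z‖ ^ 2) * Real.sqrt (1 + ‖w‖ ^ 2))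

/-- Locally uniform convergence on `U` of a sequence of ℂ-valued functions towards a
function with values in the Riemann sphere, with respect to the spherical metric. -/
def SphLocUnifConvOn (F : ℕ → ℂ → ℂ) (g : ℂ → Option ℂ) (U : Set ℂ) : Prop :=
  ∀ K : Set ℂ, K ⊆ U → IsCompact K → ∀ ε : ℝ, 0 < ε →
    ∀ᶠ n in atTop, ∀ z ∈ K, chordalDist (some (F n z)) (g z) < ε

/-- The Fatou set: points having a neighborhood on which every sequence of iterates has a
subsequence converging locally uniformly with respect to the spherical metric. -/
def fatouSet (f : ℂ → ℂ) : Set ℂ :=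
  {z | ∃ U ∈ 𝓝 z, ∀ φ : ℕ → ℕ, StrictMono φ →
    ∃ ψ : ℕ → ℕ, StrictMono ψ ∧ ∃ g : ℂ → Option ℂ,
      SphLocUnifConvOn (fun n => f^[φ (ψ n)]) g U}

/-- The Julia set. -/
def juliaSet (f : ℂ → ℂ) : Set ℂ := (fatouSet f)ᶜ

/-- The escaping set. -/
def escapingSet (f : ℂ → ℂ) : Set ℂ :=
  {z | Tendsto (fun n => ‖f^[n] z‖) atTop atTop}

/-- The Fatou set has no multiply connected component. -/
def NoMultiplyConnectedFatouComponent (f : ℂ → ℂ) : Prop :=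
  ∀ z ∈ fatouSet f, SimplyConnectedSpace (connectedComponentIn (fatouSet f) z)

/-- Maximum modulus M(r,f). -/
noncomputable def maxMod (f : ℂ → ℂ) (r : ℝ) : ℝ :=
  sSup ((fun z => ‖f z‖) '' {z : ℂ | ‖z‖ = r})

/-- The order ρ(f) of an entire function, as an extended real number. -/
noncomputable def entireOrder (f : ℂ → ℂ) : EReal :=
  limsup (fun r : ℝ => ((Real.log (Real.log (maxMod f r)) / Real.log r : ℝ) : EReal)) atTop

/-- The fast escaping set A(f). -/
def fastEscapingSet (f : ℂ → ℂ) : Set ℂ :=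
  {z | ∃ R : ℝ, 0 < R ∧ (∀ r : ℝ, R ≤ r → r < maxMod f r) ∧
    ∃ L : ℕ, ∀ n : ℕ, L < n → (maxMod f)^[n - L] R ≤ ‖f^[n] z‖}

/-- `f` is a transcendental entire function. -/
def TranscendentalEntire (f : ℂ → ℂ) : Prop :=
  Differentiable ℂ f ∧ ¬ ∃ p : Polynomial ℂ, ∀ z, f z = p.eval z

/-- Order of vanishing of `g` at `z` (the least `k` with nonzero `k`-th derivative). -/
noncomputable def vanishingOrder (g : ℂ → ℂ) (z : ℂ) : ℕ :=
  sInf {k : ℕ | iteratedDeriv k g z ≠ 0}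

/-- n(r,a): the number of solutions of f(z) = a with |z| ≤ r, counted with multiplicity. -/
noncomputable def nCount (f : ℂ → ℂ) (a : ℂ) (r : ℝ) : ℕ :=
  ∑ᶠ z ∈ {z : ℂ | ‖z‖ ≤ r ∧ f z = a}, vanishingOrder (fun w => f w - a) z

/-- n(r) = max over a of n(r,a). -/
noncomputable def nMax (f : ℂ → ℂ) (r : ℝ) : ℕ := ⨆ a : ℂ, nCount f a r

/-- Critical values of `f`. -/
def criticalValues (f : ℂ → ℂ) : Set ℂ := {w | ∃ z, deriv f z = 0 ∧ f z = w}

/-- Finite asymptotic values of `f`. -/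
def asymptoticValues (f : ℂ → ℂ) : Set ℂ :=
  {w | ∃ γ : ℝ → ℂ, Continuous γ ∧ Tendsto (fun t => ‖γ t‖) atTop atTop ∧
    Tendsto (fun t => f (γ t)) atTop (𝓝 w)}

/-- The Eremenko–Lyubich class B. -/
def ELClass (f : ℂ → ℂ) : Prop :=
  TranscendentalEntire f ∧ Bornology.IsBounded (criticalValues f ∪ asymptoticValues f)

/-- Semihyperbolic polynomial. -/
def SemiHyperbolic (p : Polynomial ℂ) : Prop :=
  ∃ ε : ℝ, 0 < ε ∧ ∃ N : ℕ, ∀ z ∈ juliaSet (fun w => p.eval w), ∀ n : ℕ, 1 ≤ n →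
    ∀ V : Set ℂ, (∃ u ∈ (fun w => p.eval w)^[n] ⁻¹' ball z ε,
        V = connectedComponentIn ((fun w => p.eval w)^[n] ⁻¹' ball z ε) u) →
      ∀ w ∈ ball z ε,
        (∑ᶠ u ∈ {u : ℂ | u ∈ V ∧ (fun v => p.eval v)^[n] u = w},
          vanishingOrder (fun ζ => (fun v => p.eval v)^[n] ζ - w) u) ≤ N

/-- The lattice point m + nτ. -/
noncomputable def latticePoint (τ : ℂ) (q : ℤ × ℤ) : ℂ := (q.1 : ℂ) + (q.2 : ℂ) * τ

/-- The Weierstraß σ-function of the lattice ℤ + ℤτ. -/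
noncomputable def wSigma (τ : ℂ) (z : ℂ) : ℂ :=
  z * ∏' q : {q : ℤ × ℤ // q ≠ (0, 0)},
    (1 - z / latticePoint τ q.1) *
      Complex.exp (z / latticePoint τ q.1 + z ^ 2 / (2 * latticePoint τ q.1 ^ 2))

/-- The Weierstraß ζ-function ζ = σ'/σ. -/
noncomputable def wZeta (τ : ℂ) (z : ℂ) : ℂ := deriv (wSigma τ) z / wSigma τ z

/-- The constant η₁ = 2ζ(1/2). -/
noncomputable def wEta1 (τ : ℂ) : ℂ := 2 * wZeta τ (1 / 2)

/-- If every measurable set has a preimage inside `G` of at most half its measure and `S \ G` has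
finite measure, then a non-null part of a set `S` of infinite measure never leaves `G`. -/
theorem measure_forall_iterate_mem_ne_zero {α : Type*} [MeasurableSpace α] {μ : Measure α}
    {f : α → α} (hf : Measurable f) {S G : Set α} (hS : MeasurableSet S) (hG : MeasurableSet G)
    (hmaps : ∀ z ∈ G, f z ∈ S) (hbad : μ (S \ G) ≠ ∞) (hinf : μ S = ∞)
    (hcontr : ∀ Y, MeasurableSet Y → μ (G ∩ f ⁻¹' Y) ≤ 2⁻¹ * μ Y) :
    μ {z | ∀ n, f^[n] z ∈ G} ≠ 0 := by
  intro hX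
  let B : ℕ → Set α := fun n => Nat.rec (S \ G) (fun _ B => G ∩ f ⁻¹' B) n
  have hB : ∀ n, MeasurableSet (B n) := fun n => by
    induction n with
    | zero => exact hS.diff hG
    | succ n ih => exact hG.inter (hf ih)
  have hμ : ∀ n, μ (B n) ≤ 2⁻¹ ^ n * μ (S \ G) := fun n => by
    induction n with
    | zero => simp [B]
    | succ n ih =>
      calc μ (B (n + 1)) ≤ 2⁻¹ * μ (B n) := hcontr _ (hB n)
        _ ≤ 2⁻¹ * (2⁻¹ ^ n * μ (S \ G)) := by gcongr
        _ = _ := by rw [pow_succ', mul_assoc]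
  have hmem : ∀ n, ∀ z ∈ S, f^[n] z ∉ G → z ∈ ⋃ m, B m := fun n => by
    induction n with
    | zero => exact fun z hz hzG => mem_iUnion.2 ⟨0, hz, hzG⟩
    | succ n ih =>
      intro z hz hzG
      by_cases h : z ∈ G
      · obtain ⟨m, hm⟩ := mem_iUnion.1 (ih (f z) (hmaps z h) hzG)
        exact mem_iUnion.2 ⟨m + 1, h, hm⟩
      · exact mem_iUnion.2 ⟨0, hz, h⟩
  have hsub : S ⊆ {z | ∀ n, f^[n] z ∈ G} ∪ ⋃ m, B m := by
    intro z hz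
    by_cases h : ∀ n, f^[n] z ∈ G
    · exact Or.inl h
    · push Not at h
      exact Or.inr (hmem _ z hz h.choose_spec)
  have : μ S ≤ 2 * μ (S \ G) := calc
    μ S ≤ μ {z | ∀ n, f^[n] z ∈ G} + μ (⋃ m, B m) :=
      (measure_mono hsub).trans (measure_union_le _ _)
    _ ≤ 0 + ∑' n, 2⁻¹ ^ n * μ (S \ G) := by
      rw [hX]; gcongr; exact (measure_iUnion_le _).trans (ENNReal.tsum_le_tsum hμ)
    _ = 2 * μ (S \ G) := by
      rw [ENNReal.tsum_mul_right, ENNReal.tsum_geometric, zero_add]; simp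
  rw [hinf] at this
  exact (ENNReal.mul_ne_top (by simp) hbad) (top_le_iff.1 this)

/-- A point whose orbit tends to infinity is a Julia point if it is a limit of points that are
eventually mapped to a fixed point at the origin. -/
theorem mem_juliaSet_of_escaping {f : ℂ → ℂ} (hf : Continuous f) (h0 : f 0 = 0) {z : ℂ}
    (hesc : Tendsto (fun n => ‖f^[n] z‖) atTop atTop)
    (hz : ∀ ε > 0, ∃ z' ∈ ball z ε, ∃ n, f^[n] z' = 0) : z ∈ juliaSet f := by
  rintro ⟨U, hU, hnorm⟩
  obtain ⟨ψ, hψ, g, hg⟩ := hnorm id strictMono_id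
  obtain ⟨r, hr, hrU⟩ := nhds_basis_closedBall.mem_iff.1 hU
  have hg' := hg _ hrU (isCompact_closedBall z r)
  have hpos : ∀ w : ℂ, 0 < Real.sqrt (1 + ‖w‖ ^ 2) := fun w => Real.sqrt_pos.2 (by positivity)
  have hle : ∀ w : ℂ, Real.sqrt (1 + ‖w‖ ^ 2) ≤ 1 + ‖w‖ := fun w =>
    Real.sqrt_le_iff.2 ⟨by positivity, by nlinarith [norm_nonneg w]⟩
  have hψesc : Tendsto (fun n => ‖f^[ψ n] z‖) atTop atTop := hesc.comp hψ.tendsto_atTop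
  have hgz : g z = none := by
    rcases hgz : g z with _ | w
    · rfl
    have h1 := hg' (1 / (2 * Real.sqrt (1 + ‖w‖ ^ 2))) (by have := hpos w; positivity)
    obtain ⟨n, hn1, hn2⟩ := (h1.and (hψesc.eventually_ge_atTop (2 * ‖w‖ + 1))).exists
    have h3 := hn1 z (mem_closedBall_self hr.le)
    simp only [hgz, chordalDist, id] at h3
    rw [div_lt_div_iff₀ (by have := hpos w; have := hpos (f^[ψ n] z); positivity)
      (by have := hpos w; positivity)] at h3
    have h4 := hle (f^[ψ n] z)
    have h5 : ‖f^[ψ n] z‖ - ‖w‖ ≤ ‖f^[ψ n] z - w‖ := norm_sub_norm_le _ _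
    have h6 : 4 * ‖f^[ψ n] z - w‖ < Real.sqrt (1 + ‖f^[ψ n] z‖ ^ 2) :=
      lt_of_mul_lt_mul_right (by linarith) (hpos w).le
    linarith [norm_nonneg w]
  obtain ⟨n, hn⟩ := (hg' (1 / 4) (by norm_num)).exists
  have hbig : 7 < ‖f^[ψ n] z‖ := by
    have h3 := hn z (mem_closedBall_self hr.le)
    simp only [hgz, chordalDist, id] at h3
    rw [div_lt_div_iff₀ (hpos _) (by norm_num)] at h3
    linarith [hle (f^[ψ n] z)]
  have hcont : ∀ᶠ z' in 𝓝 z, 7 < ‖f^[ψ n] z'‖ :=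
    ((hf.iterate (ψ n)).norm.tendsto z).eventually (lt_mem_nhds hbig)
  obtain ⟨ε, hε, hball⟩ := Metric.eventually_nhds_iff_ball.1 hcont
  obtain ⟨z', hz', m, hm⟩ := hz (min ε r) (lt_min hε hr)
  have hzr : z' ∈ closedBall z r := ball_subset_closedBall (ball_subset_ball (min_le_right _ _) hz')
  have hzero : ∀ j, m ≤ j → f^[j] z' = 0 := by
    intro j hj
    obtain ⟨i, rfl⟩ := Nat.exists_eq_add_of_le' hj
    rw [Function.iterate_add_apply, hm]
    exact Function.iterate_fixed h0 i
  have hgz' : g z' = some 0 := by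
    have key : ∀ ε > 0, chordalDist (some 0) (g z') < ε := fun ε hε => by
      obtain ⟨j, hj1, hj2⟩ := ((hg' ε hε).and (hψ.tendsto_atTop.eventually_ge_atTop m)).exists
      have := hj1 z' hzr
      simpa only [id, hzero _ hj2] using this
    rcases hgz : g z' with _ | w
    · have := key 2 (by norm_num)
      simp [hgz, chordalDist] at this
    · by_contra hw
      have hw : w ≠ 0 := fun h => hw (by rw [h])
      have := key (2 * ‖w‖ / Real.sqrt (1 + ‖w‖ ^ 2))
        (by have := hpos w; have := norm_pos_iff.2 hw; positivity)
      simp [hgz, chordalDist] at this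
  have h3 := hn z' hzr
  have h4 := hball z' (ball_subset_ball (min_le_left _ _) hz')
  simp only [hgz', chordalDist, id] at h3
  simp only [sub_zero, norm_zero] at h3
  rw [div_lt_div_iff₀ (by have := hpos (f^[ψ n] z'); positivity) (by norm_num)] at h3
  norm_num at h3
  linarith [hle (f^[ψ n] z')]

theorem norm_le_maxMod {f : ℂ → ℂ} (hf : Continuous f) (z : ℂ) : ‖f z‖ ≤ maxMod f ‖z‖ := by
  have hc : IsCompact ((fun z => ‖f z‖) '' {w : ℂ | ‖w‖ = ‖z‖}) := by
    have : {w : ℂ | ‖w‖ = ‖z‖} = sphere 0 ‖z‖ := by ext; simp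
    rw [this]
    exact (isCompact_sphere _ _).image hf.norm
  exact le_csSup hc.bddAbove ⟨z, rfl, rfl⟩

theorem maxMod_le {f : ℂ → ℂ} {r B : ℝ} (hB : 0 ≤ B) (h : ∀ z, ‖z‖ = r → ‖f z‖ ≤ B) :
    maxMod f r ≤ B :=
  Real.sSup_le (by rintro _ ⟨z, hz, rfl⟩; exact h z hz) hB

/-- An entire function with two zeros that is not identically zero outgrows the identity. -/
theorem exists_forall_lt_maxMod {f : ℂ → ℂ} (hf : Differentiable ℂ f) (h0 : f 0 = 0)
    (h1 : f 1 = 0) {a : ℂ} (ha : f a ≠ 0) : ∃ R₀ > 0, ∀ r ≥ R₀, r < maxMod f r := by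
  by_contra! hcon
  have hbound : ∀ z, ‖deriv f z‖ ≤ 2 := by
    intro z
    obtain ⟨r, hr, hM⟩ := hcon (2 * ‖z‖ + 1) (by positivity)
    have hrpos : 0 < r := by linarith [norm_nonneg z]
    have hball : ∀ w ∈ closedBall (0 : ℂ) r, ‖f w‖ ≤ r := by
      intro w hw
      refine Complex.norm_le_of_forall_mem_frontier_norm_le (isBounded_ball (x := 0) (r := r))
        hf.diffContOnCl (fun v hv => ?_) (by rwa [closure_ball _ hrpos.ne'])
      rw [frontier_ball _ hrpos.ne', mem_sphere_zero_iff_norm] at hv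
      calc ‖f v‖ ≤ maxMod f ‖v‖ := norm_le_maxMod hf.continuous v
        _ ≤ r := by rwa [hv]
    have := Complex.norm_deriv_le_of_forall_mem_sphere_norm_le (c := z) (R := r / 2) (C := r)
      (by positivity) hf.diffContOnCl (fun w hw => hball w ?_)
    · rwa [div_div_eq_mul_div, mul_div_cancel_left₀ _ hrpos.ne'] at this
    · rw [mem_closedBall_zero_iff]
      have h3 := norm_le_norm_add_norm_sub' w z
      rw [mem_sphere_iff_norm] at hw
      linarith
  have hconst : ∀ z, deriv f z = deriv f 0 := fun z =>
    hf.deriv.apply_eq_apply_of_bounded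
      (isBounded_iff_forall_norm_le.2 ⟨2, by rintro _ ⟨w, rfl⟩; exact hbound w⟩) z 0
  have haff : ∀ z, f z - deriv f 0 * z = 0 := by
    intro z
    have hd : Differentiable ℂ fun z => f z - deriv f 0 * z := hf.sub (by fun_prop)
    have := is_const_of_deriv_eq_zero hd (fun w => by
      rw [deriv_fun_sub hf.differentiableAt (by fun_prop)]
      simp [hconst w]) z 0
    simpa [h0] using this
  have hd0 : deriv f 0 = 0 := by simpa [h1] using haff 1
  exact ha (by simpa [hd0] using haff a)

theorem mem_fastEscapingSet_of_growth {f : ℂ → ℂ} {C R : ℝ} (hC : 0 ≤ C)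
    (hup : ∀ z, ‖f z‖ ≤ Real.exp (C * (1 + ‖z‖ ^ 2))) (hR : 1 ≤ R)
    (hM : ∀ r ≥ R, r < maxMod f r) {z : ℂ} (hz : R ^ 2 ≤ ‖z‖)
    (hgrow : ∀ n, Real.exp (2 * C * (1 + ‖f^[n] z‖)) ≤ ‖f^[n + 1] z‖) :
    z ∈ fastEscapingSet f := by
  refine ⟨R, by linarith, hM, 0, fun n _ => ?_⟩
  have key : ∀ n, R ≤ (maxMod f)^[n] R ∧ ((maxMod f)^[n] R) ^ 2 ≤ ‖f^[n] z‖ := by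
    intro n
    induction n with
    | zero => exact ⟨le_rfl, hz⟩
    | succ n ih =>
      obtain ⟨h1, h2⟩ := ih
      rw [Function.iterate_succ_apply']
      set s := (maxMod f)^[n] R
      have h3 := hM s h1
      refine ⟨by linarith, ?_⟩
      have h4 : maxMod f s ≤ Real.exp (C * (1 + s ^ 2)) :=
        maxMod_le (Real.exp_nonneg _) fun w hw => hw ▸ hup w
      calc maxMod f s ^ 2 ≤ Real.exp (C * (1 + s ^ 2)) ^ 2 := by gcongr; linarith
        _ = Real.exp (2 * C * (1 + s ^ 2)) := by rw [← Real.exp_nat_mul]; push_cast; ring_nf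
        _ ≤ Real.exp (2 * C * (1 + ‖f^[n] z‖)) := by gcongr
        _ ≤ _ := hgrow n
  obtain ⟨h1, h2⟩ := key n
  rw [Nat.sub_zero]
  nlinarith

/-- The measure with density `‖z‖⁻²` on the plane. -/
noncomputable def logMeasure : Measure ℂ :=
  volume.withDensity fun z => ENNReal.ofReal ((‖z‖ ^ 2)⁻¹)

/-- Positivity of the area of `J(f) ∩ A(f)` from a set `G` on which `f` expands, grows fast, and
contracts the logarithmic measure under pull-back. -/
theorem volume_juliaSet_inter_fastEscapingSet_pos {f : ℂ → ℂ} (hf : Differentiable ℂ f)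
    (h0 : f 0 = 0) {Λ : Set ℂ} {κ : ℝ} (hΛ : ∀ w ∈ Λ, f w = 0)
    (hcover : ∀ z, ∃ w ∈ Λ, ‖w - z‖ ≤ κ)
    {C R R₀ : ℝ} (hC : 1 ≤ C) (hup : ∀ z, ‖f z‖ ≤ Real.exp (C * (1 + ‖z‖ ^ 2)))
    (hR₀ : 1 ≤ R₀) (hM : ∀ r ≥ R₀, r < maxMod f r) (hR : R₀ ^ 2 ≤ R)
    {G : Set ℂ} (hG : MeasurableSet G) (hGR : ∀ z ∈ G, R ≤ ‖z‖)
    (hgrow : ∀ z ∈ G, Real.exp (2 * C * (1 + ‖z‖)) ≤ ‖f z‖)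
    (hexp : ∀ z ∈ G, ∀ w, ‖w - f z‖ ≤ κ → ∃ z', f z' = w ∧ ‖z' - z‖ ≤ 2⁻¹ * ‖w - f z‖)
    (hbad : logMeasure ({z | R ≤ ‖z‖} \ G) ≠ ∞) (hinf : logMeasure {z | R ≤ ‖z‖} = ∞)
    (hcontr : ∀ Y, MeasurableSet Y → logMeasure (G ∩ f ⁻¹' Y) ≤ 2⁻¹ * logMeasure Y) :
    0 < volume (juliaSet f ∩ fastEscapingSet f) := by
  have hstep : ∀ z ∈ G, ‖z‖ + 1 ≤ ‖f z‖ := fun z hz => by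
    have := Real.add_one_le_exp (2 * C * (1 + ‖z‖))
    nlinarith [hgrow z hz, norm_nonneg z]
  have hX := measure_forall_iterate_mem_ne_zero hf.continuous.measurable (S := {z | R ≤ ‖z‖})
    (measurableSet_le measurable_const measurable_norm) hG
    (fun z hz => show R ≤ ‖f z‖ by linarith [hstep z hz, hGR z hz]) hbad hinf hcontr
  have hκ : 0 ≤ κ := by
    obtain ⟨w, -, hw⟩ := hcover 0
    exact (norm_nonneg _).trans hw
  refine pos_iff_ne_zero.2 fun hvol => hX (measure_mono_null (fun z hz => ?_)
    (withDensity_absolutelyContinuous _ _ hvol))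
  have hz : ∀ n, f^[n] z ∈ G := hz
  have hge : ∀ n : ℕ, (n : ℝ) ≤ ‖f^[n] z‖ := fun n => by
    induction n with
    | zero => simp
    | succ n ih =>
      rw [Function.iterate_succ_apply']
      push_cast
      linarith [hstep _ (hz n)]
  constructor
  · have hback : ∀ n, ∀ z, (∀ m, f^[m] z ∈ G) → ∀ w, ‖w - f^[n] z‖ ≤ κ →
        ∃ z', f^[n] z' = w ∧ ‖z' - z‖ ≤ 2⁻¹ ^ n * κ := by
      intro n
      induction n with
      | zero => exact fun z _ w hw => ⟨w, rfl, by simpa using hw⟩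
      | succ n ih =>
        intro z hz w hw
        obtain ⟨y, hy, hyz⟩ := ih (f z) (fun m => hz (m + 1)) w hw
        have hpow : (2⁻¹ : ℝ) ^ n * κ ≤ κ :=
          mul_le_of_le_one_left hκ (pow_le_one₀ (by norm_num) (by norm_num))
        obtain ⟨z', hz', hzz'⟩ := hexp z (hz 0) y (hyz.trans hpow)
        refine ⟨z', by rw [Function.iterate_succ_apply, hz', hy], hzz'.trans ?_⟩
        rw [pow_succ']
        nlinarith
    refine mem_juliaSet_of_escaping hf.continuous h0
      (tendsto_atTop_mono hge tendsto_natCast_atTop_atTop) fun ε hε => ?_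
    have hlim : Tendsto (fun n : ℕ => (2⁻¹ : ℝ) ^ n * κ) atTop (𝓝 (0 * κ)) :=
      (_root_.tendsto_pow_atTop_nhds_zero_of_lt_one (by norm_num) (by norm_num)).mul_const κ
    rw [zero_mul] at hlim
    obtain ⟨n, hn⟩ := (hlim.eventually (gt_mem_nhds hε)).exists
    obtain ⟨w, hwΛ, hw⟩ := hcover (f^[n] z)
    obtain ⟨z', hz', hzz'⟩ := hback n z hz w hw
    exact ⟨z', mem_ball_iff_norm.2 (hzz'.trans_lt hn), n + 1, by
      rw [Function.iterate_succ_apply', hz', hΛ w hwΛ]⟩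
  · refine mem_fastEscapingSet_of_growth (by linarith) hup hR₀ hM (hR.trans (hGR z (hz 0)))
      fun n => ?_
    rw [Function.iterate_succ_apply']
    exact hgrow _ (hz n)

/-- A holomorphic logarithm of a zero-free function on a disc. -/
theorem exists_log_branch {f : ℂ → ℂ} (hf : Differentiable ℂ f) {z₀ : ℂ} {r : ℝ} (hr : 0 < r)
    (hne : ∀ z ∈ ball z₀ r, f z ≠ 0) :
    ∃ g : ℂ → ℂ, (∀ z ∈ ball z₀ r, HasDerivAt g (deriv f z / f z) z) ∧
      ∀ z ∈ ball z₀ r, f z = Complex.exp (g z) := by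
  have hd : DifferentiableOn ℂ (fun z => deriv f z / f z) (ball z₀ r) :=
    hf.deriv.differentiableOn.div hf.differentiableOn hne
  obtain ⟨g, hg0, hg⟩ := hd.isExactOn_ball.with_val_at z₀ (Complex.log (f z₀))
  refine ⟨g, hg, fun z hz => ?_⟩
  have hz₀ := mem_ball_self (x := z₀) hr
  have hderiv : ∀ w ∈ ball z₀ r, HasDerivAt (fun z => f z * Complex.exp (-g z)) 0 w := by
    intro w hw
    convert! (hf w).hasDerivAt.mul (hg w hw).neg.cexp using 1
    field_simp [hne w hw]
    ring
  have := isOpen_ball.is_const_of_deriv_eq_zero (convex_ball z₀ r).isPreconnected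
    (fun w hw => (hderiv w hw).differentiableAt.differentiableWithinAt)
    (fun w hw => (hderiv w hw).deriv) hz hz₀
  rw [hg0, Complex.exp_neg (Complex.log _), Complex.exp_log (hne _ hz₀),
    mul_inv_cancel₀ (hne _ hz₀), Complex.exp_neg] at this
  exact eq_of_div_eq_one (by rwa [div_eq_mul_inv])

/-- If the derivative of `g` on a disc is close to its value at the centre, so are the difference
quotients of `g`. -/
theorem norm_sub_sub_le_of_hasDerivAt {g g' : ℂ → ℂ} {z₀ : ℂ} {r B : ℝ}
    (hg : ∀ z ∈ ball z₀ r, HasDerivAt g (g' z) z) (hB : ∀ z ∈ ball z₀ r, ‖g' z - g' z₀‖ ≤ B)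
    {z w : ℂ} (hz : z ∈ ball z₀ r) (hw : w ∈ ball z₀ r) :
    ‖g z - g w - g' z₀ * (z - w)‖ ≤ B * ‖z - w‖ := by
  have := (convex_ball z₀ r).norm_image_sub_le_of_norm_hasDerivWithin_le
    (f := fun z => g z - g' z₀ * z) (f' := fun z => g' z - g' z₀) (C := B)
    (fun x hx => by
      simpa using ((hg x hx).fun_sub ((hasDerivAt_id x).const_mul (g' z₀))).hasDerivWithinAt)
    hB hw hz
  rwa [show g z - g w - g' z₀ * (z - w) = g z - g' z₀ * z - (g w - g' z₀ * w) by ring]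

section LocalEstimates

variable {f : ℂ → ℂ} {z₀ : ℂ} {r : ℝ}

/-- Surjectivity with contraction of a local inverse branch. -/
theorem exists_preimage_near (hf : Differentiable ℂ f) (hne : ∀ z ∈ ball z₀ r, f z ≠ 0)
    (hL : ∀ z ∈ ball z₀ r, ‖deriv f z / f z - deriv f z₀ / f z₀‖ ≤ ‖deriv f z₀ / f z₀‖ / 2)
    (hr : 0 < r) (hrL : 2 ≤ ‖deriv f z₀ / f z₀‖ * r) (hbig : 32 ≤ ‖f z₀‖ * ‖deriv f z₀ / f z₀‖)
    {w : ℂ} (hw : 48 * ‖w - f z₀‖ ≤ ‖f z₀‖) :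
    ∃ z, f z = w ∧ ‖z - z₀‖ ≤ 2⁻¹ * ‖w - f z₀‖ := by
  obtain ⟨g, hg, hfg⟩ := exists_log_branch hf hr hne
  have hz₀ := mem_ball_self (x := z₀) hr
  set l := ‖deriv f z₀ / f z₀‖ with hl
  have hlpos : 0 < l := pos_of_mul_pos_left (by linarith) hr.le
  have hfpos : 0 < ‖f z₀‖ := norm_pos_iff.2 (hne _ hz₀)
  rcases eq_or_ne w (f z₀) with rfl | hwne
  · exact ⟨z₀, rfl, by simp⟩
  have hdpos : 0 < ‖w - f z₀‖ := norm_pos_iff.2 (sub_ne_zero.2 hwne)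
  set d := ‖w - f z₀‖
  set s := 16 * d / (‖f z₀‖ * l) with hs
  have hspos : 0 < s := by positivity
  have hsl : ‖f z₀‖ * l * s = 16 * d := by rw [hs]; field_simp
  have hsl3 : 3 * (l * s) ≤ 1 := by
    by_contra! h
    nlinarith
  have hsr : s < r := by nlinarith
  have hsd : s ≤ 2⁻¹ * d := by nlinarith
  have hsphere : ∀ z ∈ sphere z₀ s, 4 * d ≤ ‖f z - f z₀‖ := by
    intro z hz
    have hzr : z ∈ ball z₀ r := sphere_subset_closedBall.trans (closedBall_subset_ball hsr) hz
    rw [mem_sphere_iff_norm] at hz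
    have h1 := norm_sub_sub_le_of_hasDerivAt hg hL hzr hz₀
    have h2 : ‖deriv f z₀ / f z₀ * (z - z₀)‖ = l * s := by rw [norm_mul, hz]
    rw [hz] at h1
    have h3 := norm_le_norm_add_norm_sub' (g z - g z₀) (deriv f z₀ / f z₀ * (z - z₀))
    have h4 := norm_sub_norm_le (deriv f z₀ / f z₀ * (z - z₀)) (g z - g z₀)
    rw [norm_sub_rev (deriv f z₀ / f z₀ * (z - z₀))] at h4
    rw [h2] at h3 h4
    set u := g z - g z₀ with hu
    have h5 := Complex.norm_exp_sub_one_sub_id_le (x := u) (by nlinarith)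
    have h6 : ‖u‖ - ‖Complex.exp u - 1‖ ≤ ‖Complex.exp u - 1 - u‖ := by
      rw [norm_sub_rev (Complex.exp u - 1)]; exact norm_sub_norm_le _ _
    have h7 : f z - f z₀ = f z₀ * (Complex.exp u - 1) := by
      rw [hu, Complex.exp_sub, ← hfg z hzr, ← hfg z₀ hz₀]
      field_simp [hne z₀ hz₀]
    have h8 : l * s / 4 ≤ ‖Complex.exp u - 1‖ := by
      have : ‖u‖ ^ 2 ≤ ‖u‖ / 2 := by nlinarith [norm_nonneg u]
      linarith
    rw [h7, norm_mul]
    nlinarith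
  have hfreq : ∃ᶠ z in 𝓝 z₀, f z ≠ f z₀ := by
    intro h
    simp only [not_not] at h
    have hz : deriv f z₀ = 0 := by
      rw [Filter.EventuallyEq.deriv_eq (f := fun _ => f z₀) h]; simp
    rw [hl, hz] at hlpos
    simp at hlpos
  have hmem : w ∈ ball (f z₀) (4 * d / 2) := mem_ball_iff_norm.2 (by change d < _; linarith)
  obtain ⟨z, hz, hzw⟩ := (hf.diffContOnCl (s := ball z₀ s)).ball_subset_image_closedBall hspos
    hsphere hfreq hmem
  exact ⟨z, hzw, (mem_closedBall_iff_norm.1 hz).trans hsd⟩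

theorem abs_det_restrictScalars_mul (a : ℂ) :
    |((ContinuousLinearMap.toSpanSingleton ℂ a).restrictScalars ℝ).det| = ‖a‖ ^ 2 := by
  simp [ContinuousLinearMap.det, LinearMap.det_restrictScalars, Algebra.norm_complex_eq,
    Complex.normSq_eq_norm_sq]

/-- Change of variables for an injective holomorphic map and the logarithmic measure. -/
theorem setLIntegral_logDeriv_le_logMeasure (hf : Differentiable ℂ f) {S Y : Set ℂ}
    (hS : MeasurableSet S) (hinj : InjOn f S) (hSY : MapsTo f S Y) :
    ∫⁻ z in S, ENNReal.ofReal (‖deriv f z / f z‖ ^ 2) ≤ logMeasure Y := by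
  have hcv := lintegral_image_eq_lintegral_abs_det_fderiv_mul volume hS
    (fun z _ => ((hf z).hasDerivAt.hasFDerivAt.restrictScalars ℝ).hasFDerivWithinAt) hinj
    (fun w => ENNReal.ofReal ((‖w‖ ^ 2)⁻¹))
  calc ∫⁻ z in S, ENNReal.ofReal (‖deriv f z / f z‖ ^ 2)
      = ∫⁻ w in f '' S, ENNReal.ofReal ((‖w‖ ^ 2)⁻¹) := by
        rw [hcv]
        refine lintegral_congr fun z => ?_
        rw [abs_det_restrictScalars_mul, ← ENNReal.ofReal_mul (by positivity), norm_div, div_pow,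
          div_eq_mul_inv]
    _ ≤ logMeasure (f '' S) := withDensity_apply_le _ _
    _ ≤ logMeasure Y := measure_mono hSY.image_subset

end LocalEstimates

/-- The logarithmic measure of a preimage inside a disc on which the logarithmic derivative is
nearly constant. -/
theorem logMeasure_inter_preimage_le {f : ℂ → ℂ} {z₀ : ℂ} {r : ℝ} (hf : Differentiable ℂ f)
    (hne : ∀ z ∈ ball z₀ r, f z ≠ 0)
    (hL : ∀ z ∈ ball z₀ r, ‖deriv f z / f z - deriv f z₀ / f z₀‖ ≤ ‖deriv f z₀ / f z₀‖ / 2)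
    (hr : 0 < r) (hrL : 2 ≤ ‖deriv f z₀ / f z₀‖ * r) {a : ℝ} (ha : 0 < a) {P Y : Set ℂ}
    (hP : MeasurableSet P) (hPr : P ⊆ ball z₀ r) (hPa : ∀ z ∈ P, a ≤ ‖z‖) (hY : MeasurableSet Y) :
    logMeasure (P ∩ f ⁻¹' Y) ≤
      ENNReal.ofReal (8 * r / (a ^ 2 * ‖deriv f z₀ / f z₀‖)) * logMeasure Y := by
  classical
  obtain ⟨g, hg, hfg⟩ := exists_log_branch hf hr hne
  have hz₀ := mem_ball_self (x := z₀) hr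
  set l := ‖deriv f z₀ / f z₀‖ with hl
  have hlpos : 0 < l := pos_of_mul_pos_left (by linarith) hr.le
  have hgm : Measurable ((ball z₀ r).piecewise g 0) :=
    ContinuousOn.measurable_piecewise (fun z hz => (hg z hz).continuousAt.continuousWithinAt)
      continuousOn_const measurableSet_ball
  set h : ℂ → ℝ := fun z => ((ball z₀ r).piecewise g 0 z).im / (2 * Real.pi) with hh
  have hhm : Measurable h := (Complex.measurable_im.comp hgm).div_const _
  have hhg : ∀ z ∈ ball z₀ r, h z = (g z).im / (2 * Real.pi) := fun z hz => by
    simp only [hh, piecewise_eq_of_mem _ _ _ hz]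
  set S : ℤ → Set ℂ := fun j => P ∩ f ⁻¹' Y ∩ {z | ⌊h z⌋ = j} with hS
  have hSm : ∀ j, MeasurableSet (S j) := fun j =>
    (hP.inter (hf.continuous.measurable hY)).inter
      ((Int.measurable_floor.comp hhm) (measurableSet_singleton j))
  have hinj : ∀ j, InjOn f (S j) := by
    rintro j z ⟨⟨hzP, -⟩, hzj⟩ w ⟨⟨hwP, -⟩, hwj⟩ hzw
    have hz := hPr hzP
    have hw := hPr hwP
    rw [mem_ofPred_eq] at hzj hwj
    rw [hfg z hz, hfg w hw, Complex.exp_eq_exp_iff_exists_int] at hzw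
    obtain ⟨n, hn⟩ := hzw
    have him : h z = h w + n := by
      rw [hhg z hz, hhg w hw, hn]
      simp
      field_simp
    rw [him, Int.floor_add_intCast, hwj] at hzj
    have hn0 : n = 0 := by omega
    have hgeq : g z = g w := by simp [hn, hn0]
    have h1 := norm_sub_sub_le_of_hasDerivAt hg hL hz hw
    rw [hgeq, sub_self, zero_sub, norm_neg, norm_mul, ← hl] at h1
    have : ‖z - w‖ = 0 := by nlinarith [norm_nonneg (z - w)]
    exact sub_eq_zero.1 (norm_eq_zero.1 this)
  have hpiece : ∀ j, logMeasure (S j) ≤ ENNReal.ofReal (4 / (a ^ 2 * l ^ 2)) * logMeasure Y := by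
    intro j
    calc logMeasure (S j) = ∫⁻ z in S j, ENNReal.ofReal ((‖z‖ ^ 2)⁻¹) :=
          withDensity_apply _ (hSm j)
      _ ≤ ∫⁻ z in S j,
            ENNReal.ofReal (4 / (a ^ 2 * l ^ 2)) * ENNReal.ofReal (‖deriv f z / f z‖ ^ 2) := by
          refine setLIntegral_mono' (hSm j) fun z hz => ?_
          rw [← ENNReal.ofReal_mul (by positivity)]
          refine ENNReal.ofReal_le_ofReal ?_
          have hza := hPa z hz.1.1
          have hzL : l / 2 ≤ ‖deriv f z / f z‖ := by
            have := norm_sub_norm_le (deriv f z₀ / f z₀) (deriv f z / f z)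
            rw [norm_sub_rev] at this
            linarith [hL z (hPr hz.1.1)]
          calc (‖z‖ ^ 2)⁻¹ ≤ (a ^ 2)⁻¹ := by gcongr
            _ = 4 / (a ^ 2 * l ^ 2) * (l / 2) ^ 2 := by field_simp; norm_num
            _ ≤ _ := by gcongr
      _ = ENNReal.ofReal (4 / (a ^ 2 * l ^ 2)) *
            ∫⁻ z in S j, ENNReal.ofReal (‖deriv f z / f z‖ ^ 2) :=
          lintegral_const_mul' _ _ ENNReal.ofReal_ne_top
      _ ≤ _ := by
          gcongr
          exact setLIntegral_logDeriv_le_logMeasure hf (hSm j) (hinj j) fun z hz => hz.1.2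
  set b := 3 * l * r / (4 * Real.pi) with hb
  have hcov : P ∩ f ⁻¹' Y ⊆ ⋃ j ∈ Finset.Icc ⌊h z₀ - b⌋ ⌊h z₀ + b⌋, S j := by
    intro z hz
    have hzr := hPr hz.1
    have h1 := norm_sub_sub_le_of_hasDerivAt hg hL hzr hz₀
    have h2 := norm_le_norm_add_norm_sub' (g z - g z₀) (deriv f z₀ / f z₀ * (z - z₀))
    rw [norm_mul, ← hl] at h2
    have h3 : ‖z - z₀‖ ≤ r := (mem_ball_iff_norm.1 hzr).le
    have h4 := Complex.abs_im_le_norm (g z - g z₀)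
    have h5 : |h z - h z₀| ≤ b := by
      rw [hhg z hzr, hhg z₀ hz₀, ← sub_div, abs_div, abs_of_pos Real.two_pi_pos, ← Complex.sub_im,
        hb, div_le_div_iff₀ Real.two_pi_pos (by positivity)]
      have : |(g z - g z₀).im| ≤ 3 / 2 * (l * r) := by nlinarith
      nlinarith [Real.pi_pos]
    rw [abs_le] at h5
    simp only [mem_iUnion, Finset.mem_Icc, exists_prop]
    exact ⟨⌊h z⌋, ⟨Int.floor_le_floor (by linarith), Int.floor_le_floor (by linarith)⟩, hz, rfl⟩
  have hcard : ((Finset.Icc ⌊h z₀ - b⌋ ⌊h z₀ + b⌋).card : ℝ) ≤ 2 * (l * r) := by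
    have hbpos : 0 ≤ b := by positivity
    rw [Int.card_Icc]
    have h1 : ⌊h z₀ - b⌋ ≤ ⌊h z₀ + b⌋ := Int.floor_le_floor (by linarith)
    have h2 : (((⌊h z₀ + b⌋ + 1 - ⌊h z₀ - b⌋).toNat : ℤ) : ℝ) = ⌊h z₀ + b⌋ + 1 - ⌊h z₀ - b⌋ := by
      rw [Int.toNat_of_nonneg (by omega)]
      push_cast
      ring
    rw [Int.cast_natCast] at h2
    have h3 : 2 * b ≤ l * r / 2 := by
      rw [hb, mul_div_assoc', div_le_iff₀ (by positivity)]
      nlinarith [Real.pi_gt_three, mul_pos hlpos hr]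
    linarith [Int.floor_le (h z₀ + b), Int.lt_floor_add_one (h z₀ - b)]
  calc logMeasure (P ∩ f ⁻¹' Y)
      ≤ ∑ j ∈ Finset.Icc ⌊h z₀ - b⌋ ⌊h z₀ + b⌋, logMeasure (S j) :=
        (measure_mono hcov).trans (measure_biUnion_finset_le _ _)
    _ ≤ ∑ j ∈ Finset.Icc ⌊h z₀ - b⌋ ⌊h z₀ + b⌋,
          ENNReal.ofReal (4 / (a ^ 2 * l ^ 2)) * logMeasure Y :=
        Finset.sum_le_sum fun j _ => hpiece j
    _ = ENNReal.ofReal ((Finset.Icc ⌊h z₀ - b⌋ ⌊h z₀ + b⌋).card * (4 / (a ^ 2 * l ^ 2))) *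
          logMeasure Y := by
        rw [Finset.sum_const, nsmul_eq_mul, ENNReal.ofReal_mul (by positivity),
          ENNReal.ofReal_natCast, mul_assoc]
    _ ≤ _ := by
        gcongr
        calc _ ≤ 2 * (l * r) * (4 / (a ^ 2 * l ^ 2)) := by gcongr
          _ = _ := by field_simp; ring

theorem logMeasure_le_of_le_norm {a : ℝ} (ha : 0 < a) {S : Set ℂ} (hS : MeasurableSet S)
    (h : ∀ z ∈ S, a ≤ ‖z‖) : logMeasure S ≤ ENNReal.ofReal ((a ^ 2)⁻¹) * volume S := by
  rw [logMeasure, withDensity_apply _ hS, ← setLIntegral_const]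
  refine setLIntegral_mono' hS fun z hz => ENNReal.ofReal_le_ofReal ?_
  have := h z hz
  gcongr

theorem logMeasure_norm_ge_eq_top (R : ℝ) : logMeasure {z | R ≤ ‖z‖} = ∞ := by
  obtain ⟨K, hK⟩ := pow_unbounded_of_one_lt R (by norm_num : (1 : ℝ) < 16)
  set B : ℕ → Set ℂ := fun k => ball (((2 * 16 ^ (K + k) : ℝ) : ℂ)) (16 ^ (K + k)) with hB
  have hbd : ∀ k, ∀ z ∈ B k, (16 : ℝ) ^ (K + k) < ‖z‖ ∧ ‖z‖ < 3 * 16 ^ (K + k) := by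
    intro k z hz
    rw [hB, mem_ball_iff_norm] at hz
    have h2 : ‖((2 * 16 ^ (K + k) : ℝ) : ℂ)‖ = 2 * 16 ^ (K + k) := by
      rw [Complex.norm_real, Real.norm_of_nonneg (by positivity)]
    have h3 := norm_sub_norm_le ((2 * 16 ^ (K + k) : ℝ) : ℂ) z
    have h4 := norm_sub_norm_le z ((2 * 16 ^ (K + k) : ℝ) : ℂ)
    rw [norm_sub_rev] at h3
    rw [h2] at h3 h4
    constructor <;> linarith
  have hdisj : Pairwise (Function.onFun Disjoint B) := by
    refine (pairwise_disjoint_on B).2 fun j k hjk => disjoint_left.2 fun z hzj hzk => ?_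
    have h1 := (hbd j z hzj).2
    have h2 := (hbd k z hzk).1
    have h3 : (16 : ℝ) ^ (K + j + 1) ≤ 16 ^ (K + k) := pow_le_pow_right₀ (by norm_num) (by omega)
    rw [pow_succ] at h3
    have h4 : (0 : ℝ) < 16 ^ (K + j) := by positivity
    linarith
  have hmeas : ∀ k, ENNReal.ofReal (Real.pi / 9) ≤ logMeasure (B k) := by
    intro k
    calc ENNReal.ofReal (Real.pi / 9)
        = ENNReal.ofReal (((3 * 16 ^ (K + k)) ^ 2)⁻¹) * volume (B k) := by
          rw [hB, Complex.volume_ball, ← ENNReal.ofReal_pow (by positivity),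
            ← ENNReal.ofReal_coe_nnreal, ← ENNReal.ofReal_mul (by positivity),
            ← ENNReal.ofReal_mul (by positivity)]
          congr 1
          simp only [NNReal.coe_real_pi]
          field_simp
          norm_num
      _ = ∫⁻ z in B k, ENNReal.ofReal (((3 * 16 ^ (K + k)) ^ 2)⁻¹) := (setLIntegral_const _ _).symm
      _ ≤ ∫⁻ z in B k, ENNReal.ofReal ((‖z‖ ^ 2)⁻¹) := by
          refine setLIntegral_mono' measurableSet_ball fun z hz => ENNReal.ofReal_le_ofReal ?_
          have h := hbd k z hz
          have h4 : (0 : ℝ) < 16 ^ (K + k) := by positivity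
          have h5 : 0 < ‖z‖ := h4.trans h.1
          have h6 := h.2.le
          gcongr
      _ ≤ logMeasure (B k) := withDensity_apply_le _ _
  refine top_unique ?_
  calc ∞ = ∑' _ : ℕ, ENNReal.ofReal (Real.pi / 9) :=
        (ENNReal.tsum_const_eq_top_of_ne_zero
          (ENNReal.ofReal_pos.2 (div_pos Real.pi_pos (by norm_num))).ne').symm
    _ ≤ ∑' k, logMeasure (B k) := ENNReal.tsum_le_tsum hmeas
    _ = logMeasure (⋃ k, B k) := (measure_iUnion hdisj fun k => measurableSet_ball).symm
    _ ≤ _ := measure_mono (iUnion_subset fun k z hz => by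
        have h1 : (16 : ℝ) ^ K ≤ 16 ^ (K + k) := pow_le_pow_right₀ (by norm_num) (by omega)
        exact hK.le.trans (h1.trans (hbd k z hz).1.le))

theorem volume_strip_le {u : ℂ} (hu : ‖u‖ = 1) {a b : ℝ} (ha : 0 ≤ a) :
    volume {z : ℂ | |(u * z).re| < a ∧ ‖z‖ ≤ b} ≤ ENNReal.ofReal (4 * a * b) := by
  set ρ := rotation (⟨u, by simpa [Submonoid.unitSphere] using hu⟩ : Circle)
  have hsub : {z : ℂ | |(u * z).re| < a ∧ ‖z‖ ≤ b} ⊆ ρ ⁻¹' (Icc (-a) a ×ℂ Icc (-b) b) := by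
    rintro z ⟨h1, h2⟩
    have h3 : ρ z = u * z := rfl
    have h4 : |(u * z).im| ≤ b := (Complex.abs_im_le_norm _).trans (by rwa [norm_mul, hu, one_mul])
    rw [mem_preimage, h3, Complex.mem_reProdIm]
    exact ⟨abs_le.1 h1.le, abs_le.1 h4⟩
  have hpre : (Icc (-a) a ×ℂ Icc (-b) b) =
      Complex.measurableEquivRealProd ⁻¹' (Icc (-a) a ×ˢ Icc (-b) b) := by
    ext z
    simp only [Complex.mem_reProdIm, mem_preimage, mem_prod, mem_Icc]
    rfl
  calc _ ≤ volume (ρ ⁻¹' (Icc (-a) a ×ℂ Icc (-b) b)) := measure_mono hsub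
    _ = volume (Icc (-a) a ×ℂ Icc (-b) b) :=
        ρ.measurePreserving.measure_preimage_equiv (f := ρ.toMeasurableEquiv) _
    _ = volume ((Icc (-a) a) ×ˢ Icc (-b) b) := by
        rw [hpre]; exact Complex.volume_preserving_equiv_real_prod.measure_preimage_equiv _
    _ ≤ _ := by
        rw [Measure.volume_eq_prod, Measure.prod_prod, Real.volume_Icc, Real.volume_Icc,
          ← ENNReal.ofReal_mul (by linarith)]
        exact ENNReal.ofReal_le_ofReal (by linarith)

theorem abs_le_mul_norm_latticePoint {τ : ℂ} (hτ : 0 < τ.im) (q : ℤ × ℤ) :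
    |(q.1 : ℝ)| ≤ (1 + (1 + ‖τ‖) / τ.im) * ‖latticePoint τ q‖ ∧
      |(q.2 : ℝ)| ≤ (1 + (1 + ‖τ‖) / τ.im) * ‖latticePoint τ q‖ := by
  have h1 := Complex.abs_im_le_norm (latticePoint τ q)
  have h2 : (latticePoint τ q).im = q.2 * τ.im := by simp [latticePoint]
  rw [h2, abs_mul, abs_of_pos hτ] at h1
  have h3 : |(q.2 : ℝ)| ≤ ‖latticePoint τ q‖ / τ.im := by rwa [le_div_iff₀ hτ]
  have h4 : |(q.1 : ℝ)| ≤ ‖latticePoint τ q‖ + |(q.2 : ℝ)| * ‖τ‖ := by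
    have h5 : ((q.1 : ℝ) : ℂ) = latticePoint τ q - ((q.2 : ℝ) : ℂ) * τ := by
      simp [latticePoint]
    have := norm_sub_le (latticePoint τ q) (((q.2 : ℝ) : ℂ) * τ)
    rw [← h5, norm_mul, Complex.norm_real, Complex.norm_real] at this
    exact this
  have h5 : 0 ≤ ‖latticePoint τ q‖ / τ.im := by positivity
  have h6 : (1 + (1 + ‖τ‖) / τ.im) * ‖latticePoint τ q‖ = ‖latticePoint τ q‖
      + ‖latticePoint τ q‖ / τ.im + ‖τ‖ * (‖latticePoint τ q‖ / τ.im) := by ring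
  have h7 := mul_le_mul_of_nonneg_left h3 (norm_nonneg τ)
  have h8 : 0 ≤ ‖τ‖ * (‖latticePoint τ q‖ / τ.im) := by positivity
  constructor <;> linarith [norm_nonneg (latticePoint τ q)]

theorem exists_latticePoint_near {τ : ℂ} (hτ : 0 < τ.im) (z : ℂ) :
    ∃ q, ‖latticePoint τ q - z‖ ≤ 1 + ‖τ‖ := by
  set y := z.im / τ.im
  set x := (z - y * τ).re
  have hz : z = x + y * τ := by
    apply Complex.ext <;> simp [x, y]
    field_simp
  refine ⟨(⌊x⌋, ⌊y⌋), ?_⟩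
  have h1 : latticePoint τ (⌊x⌋, ⌊y⌋) - z =
      -((Int.fract x : ℝ) : ℂ) - ((Int.fract y : ℝ) : ℂ) * τ := by
    conv_lhs => rw [hz]
    rw [← Int.self_sub_floor, ← Int.self_sub_floor]
    simp only [latticePoint]
    push_cast
    ring
  rw [h1]
  refine (norm_sub_le _ _).trans ?_
  rw [norm_neg, norm_mul, Complex.norm_real, Complex.norm_real,
    Real.norm_of_nonneg (Int.fract_nonneg _), Real.norm_of_nonneg (Int.fract_nonneg _)]
  have h2 := (Int.fract_lt_one x).le
  have h3 := mul_le_mul_of_nonneg_right (Int.fract_lt_one y).le (norm_nonneg τ)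
  linarith

/-- The points at distance at least `δ` from the lattice. -/
def latticeFar (τ : ℂ) (δ : ℝ) : Set ℂ := {z | ∀ q, δ ≤ ‖z - latticePoint τ q‖}

theorem isClosed_latticeFar (τ : ℂ) (δ : ℝ) : IsClosed (latticeFar τ δ) := by
  have : latticeFar τ δ = ⋂ q, {z | δ ≤ ‖z - latticePoint τ q‖} := by
    ext z; simp [latticeFar]
  rw [this]
  exact isClosed_iInter fun q => isClosed_le continuous_const (by fun_prop)

theorem mem_latticeFar_of_mem_ball {τ : ℂ} {δ r : ℝ} {z w : ℂ} (hz : z ∈ latticeFar τ δ)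
    (hw : w ∈ ball z r) : w ∈ latticeFar τ (δ - r) := fun q => by
  have h1 := hz q
  have h2 := norm_sub_le_norm_sub_add_norm_sub z w (latticePoint τ q)
  rw [mem_ball_iff_norm'] at hw
  linarith

/-- The part of the annulus `16 ^ k ≤ ‖z‖ < 16 ^ (k + 1)` away from the lattice and from the line
`Re (u z) = 0`. -/
def farPiece (τ u : ℂ) (k : ℕ) : Set ℂ :=
  {z | (16 ^ k ≤ ‖z‖ ∧ ‖z‖ < 16 ^ (k + 1)) ∧ z ∈ latticeFar τ (2 ^ k)⁻¹ ∧ 8 ^ k ≤ |(u * z).re|}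

theorem measurableSet_annulus (k : ℕ) :
    MeasurableSet {z : ℂ | (16 : ℝ) ^ k ≤ ‖z‖ ∧ ‖z‖ < 16 ^ (k + 1)} :=
  (measurableSet_le measurable_const measurable_norm).inter
    (measurableSet_lt measurable_norm measurable_const)

theorem measurableSet_farPiece (τ u : ℂ) (k : ℕ) : MeasurableSet (farPiece τ u k) :=
  (measurableSet_annulus k).inter ((isClosed_latticeFar τ _).measurableSet.inter
    (isClosed_le continuous_const
      (show Continuous fun z : ℂ => |(u * z).re| by fun_prop)).measurableSet)

theorem exists_logMeasure_annulus_diff_farPiece_le {τ u : ℂ} (hτ : 0 < τ.im) (hu : ‖u‖ = 1) :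
    ∃ B : ℝ, 0 ≤ B ∧ ∀ k : ℕ,
      logMeasure ({z | 16 ^ k ≤ ‖z‖ ∧ ‖z‖ < 16 ^ (k + 1)} \ farPiece τ u k) ≤
        ENNReal.ofReal (B * (1 / 2) ^ k) := by
  set M := 1 + (1 + ‖τ‖) / τ.im with hM
  have hM1 : 1 ≤ M := le_add_of_nonneg_right (by positivity)
  refine ⟨(35 * M) ^ 2 * Real.pi + 64, by positivity, fun k => ?_⟩
  have h16 : (1 : ℝ) ≤ 16 ^ k := one_le_pow₀ (by norm_num)
  set N : ℕ := ⌊17 * M * 16 ^ k⌋₊ with hN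
  have hN1 : (N : ℝ) ≤ 17 * M * 16 ^ k := Nat.floor_le (by positivity)
  set F : Finset (ℤ × ℤ) := Finset.Icc (-(N : ℤ)) N ×ˢ Finset.Icc (-(N : ℤ)) N with hF
  have hcard : (F.card : ℝ) ≤ (35 * M * 16 ^ k) ^ 2 := by
    have h1 : F.card = (2 * N + 1) ^ 2 := by
      rw [hF, Finset.card_product, Int.card_Icc, sq]
      congr 1 <;> omega
    rw [h1]
    push_cast
    gcongr
    nlinarith
  have hsub : {z | 16 ^ k ≤ ‖z‖ ∧ ‖z‖ < 16 ^ (k + 1)} \ farPiece τ u k ⊆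
      (⋃ q ∈ F, ball (latticePoint τ q) (2 ^ k)⁻¹) ∪
        {z | |(u * z).re| < 8 ^ k ∧ ‖z‖ ≤ 16 ^ (k + 1)} := by
    rintro z ⟨hz, hz'⟩
    by_cases h : 8 ^ k ≤ |(u * z).re|
    · left
      have h1 : z ∉ latticeFar τ (2 ^ k)⁻¹ := fun h1 => hz' ⟨hz, h1, h⟩
      simp only [latticeFar, mem_ofPred_eq, not_forall, not_le] at h1
      obtain ⟨q, hq⟩ := h1
      have h2 : ((2 : ℝ) ^ k)⁻¹ ≤ 1 := inv_le_one_of_one_le₀ (one_le_pow₀ (by norm_num))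
      have h3 : ‖latticePoint τ q‖ ≤ 17 * 16 ^ k := by
        have := norm_sub_norm_le (latticePoint τ q) z
        rw [norm_sub_rev] at this
        have h5 := hz.2
        rw [pow_succ] at h5
        linarith
      have h4 := abs_le_mul_norm_latticePoint hτ q
      rw [← hM] at h4
      have h5 : M * ‖latticePoint τ q‖ ≤ 17 * M * 16 ^ k := by nlinarith
      have h6 : ∀ x : ℤ, |(x : ℝ)| ≤ M * ‖latticePoint τ q‖ → x ∈ Finset.Icc (-(N : ℤ)) N := by
        intro x hx
        have h7 : x.natAbs ≤ N := by
          rw [hN]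
          refine Nat.le_floor ?_
          rw [Nat.cast_natAbs, Int.cast_abs]
          exact hx.trans h5
        rw [Finset.mem_Icc]
        omega
      simp only [mem_iUnion, exists_prop]
      exact ⟨q, Finset.mem_product.2 ⟨h6 _ h4.1, h6 _ h4.2⟩, mem_ball_iff_norm.2 hq⟩
    · exact Or.inr ⟨not_le.1 h, hz.2.le⟩
  have hvol : volume ({z | 16 ^ k ≤ ‖z‖ ∧ ‖z‖ < 16 ^ (k + 1)} \ farPiece τ u k) ≤
      ENNReal.ofReal ((35 * M * 16 ^ k) ^ 2 * (((2 ^ k)⁻¹) ^ 2 * Real.pi) +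
        4 * 8 ^ k * 16 ^ (k + 1)) := by
    refine (measure_mono hsub).trans ((measure_union_le _ _).trans ?_)
    rw [ENNReal.ofReal_add (by positivity) (by positivity)]
    refine add_le_add ?_ (volume_strip_le hu (by positivity))
    calc volume (⋃ q ∈ F, ball (latticePoint τ q) ((2 : ℝ) ^ k)⁻¹)
        ≤ ∑ q ∈ F, volume (ball (latticePoint τ q) ((2 : ℝ) ^ k)⁻¹) :=
          measure_biUnion_finset_le _ _
      _ = ENNReal.ofReal (F.card * (((2 ^ k)⁻¹) ^ 2 * Real.pi)) := by
          simp only [Complex.volume_ball]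
          rw [Finset.sum_const, nsmul_eq_mul, ENNReal.ofReal_mul (by positivity),
            ENNReal.ofReal_natCast, ENNReal.ofReal_mul (by positivity),
            ENNReal.ofReal_pow (by positivity), ← NNReal.coe_real_pi, ENNReal.ofReal_coe_nnreal]
      _ ≤ _ := by gcongr
  refine (logMeasure_le_of_le_norm (a := 16 ^ k) (by positivity)
    ((measurableSet_annulus k).diff (measurableSet_farPiece τ u k)) fun z hz => hz.1.1).trans ?_
  refine (mul_le_mul_right hvol _).trans ?_
  rw [← ENNReal.ofReal_mul (by positivity)]
  refine ENNReal.ofReal_le_ofReal ?_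
  have e8 : (8 : ℝ) ^ k = (2 ^ k) ^ 3 := by rw [← pow_mul, mul_comm, pow_mul]; norm_num
  have e16 : (16 : ℝ) ^ k = (2 ^ k) ^ 4 := by rw [← pow_mul, mul_comm k, pow_mul]; norm_num
  rw [one_div, inv_pow (2 : ℝ) k, pow_succ (16 : ℝ) k, e8, e16]
  have hx : (1 : ℝ) ≤ 2 ^ k := one_le_pow₀ (by norm_num)
  set x : ℝ := 2 ^ k
  have : ((x ^ 4) ^ 2)⁻¹ * ((35 * M * x ^ 4) ^ 2 * (x⁻¹ ^ 2 * Real.pi) + 4 * x ^ 3 * (x ^ 4 * 16)) =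
      (35 * M) ^ 2 * Real.pi * (x⁻¹ * x⁻¹) + 64 * x⁻¹ := by
    field_simp
    ring
  rw [this, add_mul]
  have h1 : x⁻¹ ≤ 1 := inv_le_one_of_one_le₀ hx
  gcongr
  exact mul_le_of_le_one_right (by positivity) h1

/-- The estimates on an entire function with zeros on a lattice needed for the construction. -/
structure LatticeGrowth (τ u : ℂ) (f : ℂ → ℂ) (C c : ℝ) : Prop where
  one_le : 1 ≤ C
  pos : 0 < c
  norm_eq_one : ‖u‖ = 1
  differentiable : Differentiable ℂ f
  apply_latticePoint : ∀ q, f (latticePoint τ q) = 0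
  norm_le : ∀ z, ‖f z‖ ≤ Real.exp (C * (1 + ‖z‖ ^ 2))
  le_norm : ∀ δ, 0 < δ → δ ≤ 1 → ∀ z ∈ latticeFar τ δ,
    c * δ * Real.exp (c * (u * z).re ^ 2) ≤ ‖f z‖
  le_norm_logDeriv : ∀ δ, 0 < δ → δ ≤ 1 → ∀ z ∈ latticeFar τ δ,
    c * |(u * z).re| ≤ ‖deriv f z / f z‖ + C / δ
  norm_logDeriv_sub_le : ∀ δ, 0 < δ → δ ≤ 1 → ∀ z ∈ latticeFar τ δ, ∀ w ∈ latticeFar τ δ,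
    ‖z - w‖ ≤ 1 → ‖deriv f z / f z - deriv f w / f w‖ ≤ C / δ

namespace LatticeGrowth

variable {τ u : ℂ} {f : ℂ → ℂ} {C c : ℝ} {k : ℕ} {z₀ : ℂ}

theorem le_norm_logDeriv_of_mem_farPiece (h : LatticeGrowth τ u f C c) (hk : 8 * C ≤ c * 4 ^ k)
    (hz₀ : z₀ ∈ farPiece τ u k) : c * 8 ^ k / 2 ≤ ‖deriv f z₀ / f z₀‖ := by
  have h2 : (1 : ℝ) ≤ 2 ^ k := one_le_pow₀ (by norm_num)
  have h1 := h.le_norm_logDeriv (2 ^ k)⁻¹ (by positivity) (inv_le_one_of_one_le₀ h2) z₀ hz₀.2.1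
  have h3 := mul_le_mul_of_nonneg_left hz₀.2.2 h.pos.le
  have e8 : (8 : ℝ) ^ k = 4 ^ k * 2 ^ k := by rw [← mul_pow]; norm_num
  have h4 := mul_le_mul_of_nonneg_right hk (zero_le_one.trans h2)
  rw [div_inv_eq_mul] at h1
  have h5 : 0 ≤ C * 2 ^ k := mul_nonneg (zero_le_one.trans h.one_le) (zero_le_one.trans h2)
  rw [e8] at h3 ⊢
  linarith

theorem norm_logDeriv_sub_le_of_mem_farPiece (h : LatticeGrowth τ u f C c)
    (hk : 8 * C ≤ c * 4 ^ k) (hz₀ : z₀ ∈ farPiece τ u k) {z : ℂ}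
    (hz : z ∈ ball z₀ ((2 ^ k)⁻¹ / 2)) :
    f z ≠ 0 ∧ ‖deriv f z / f z - deriv f z₀ / f z₀‖ ≤ ‖deriv f z₀ / f z₀‖ / 2 := by
  have h2 : (1 : ℝ) ≤ 2 ^ k := one_le_pow₀ (by norm_num)
  have h2' : ((2 : ℝ) ^ k)⁻¹ ≤ 1 := inv_le_one_of_one_le₀ h2
  have hpos : (0 : ℝ) < (2 ^ k)⁻¹ := by positivity
  have h1 := mem_latticeFar_of_mem_ball hz₀.2.1 hz
  have h3 := mem_latticeFar_of_mem_ball hz₀.2.1 (mem_ball_self (x := z₀) (half_pos hpos))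
  have e : ((2 : ℝ) ^ k)⁻¹ - (2 ^ k)⁻¹ / 2 = (2 ^ k)⁻¹ / 2 := by ring
  rw [e] at h1 h3
  refine ⟨norm_pos_iff.1 ((h.le_norm _ (by positivity) (by linarith) z h1).trans_lt' ?_), ?_⟩
  · have := h.pos
    positivity
  · rw [mem_ball_iff_norm] at hz
    refine (h.norm_logDeriv_sub_le _ (by positivity) (by linarith) z h1 z₀ h3
      (by linarith)).trans ?_
    have h4 := h.le_norm_logDeriv_of_mem_farPiece hk hz₀
    have e8 : (8 : ℝ) ^ k = 4 ^ k * 2 ^ k := by rw [← mul_pow]; norm_num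
    have : C / ((2 ^ k)⁻¹ / 2) = 2 * C * 2 ^ k := by field_simp
    have h5 := mul_le_mul_of_nonneg_right hk (zero_le_one.trans h2)
    rw [e8] at h4
    rw [this]
    linarith

theorem two_le_norm_logDeriv_mul (h : LatticeGrowth τ u f C c) (hk : 8 * C ≤ c * 4 ^ k)
    (hz₀ : z₀ ∈ farPiece τ u k) : 2 ≤ ‖deriv f z₀ / f z₀‖ * ((2 ^ k)⁻¹ / 2) := by
  have e8 : (8 : ℝ) ^ k = 4 ^ k * 2 ^ k := by rw [← mul_pow]; norm_num
  have h2 := h.one_le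
  calc (2 : ℝ) ≤ c * 4 ^ k / 4 := by linarith
    _ = c * 8 ^ k / 2 * ((2 ^ k)⁻¹ / 2) := by rw [e8]; field_simp; norm_num
    _ ≤ _ := by gcongr; exact h.le_norm_logDeriv_of_mem_farPiece hk hz₀

theorem logMeasure_farPiece_inter_preimage_le (h : LatticeGrowth τ u f C c)
    (hk : 8 * C ≤ c * 4 ^ k) {Y : Set ℂ} (hY : MeasurableSet Y) :
    logMeasure (farPiece τ u k ∩ f ⁻¹' Y) ≤
      ENNReal.ofReal (257 ^ 2 * 8 / c * (1 / 4) ^ k) * logMeasure Y := by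
  have hc := h.pos
  set N : ℕ := 128 * 32 ^ k with hN
  set F : Finset (ℤ × ℤ) := Finset.Icc (-(N : ℤ)) N ×ˢ Finset.Icc (-(N : ℤ)) N with hF
  have hcard : (F.card : ℝ) ≤ (257 * 32 ^ k) ^ 2 := by
    have h1 : F.card = (2 * N + 1) ^ 2 := by
      rw [hF, Finset.card_product, Int.card_Icc, sq]
      congr 1 <;> omega
    rw [h1, hN]
    push_cast
    gcongr
    have : (1 : ℝ) ≤ 32 ^ k := one_le_pow₀ (by norm_num)
    linarith
  set Q : ℤ × ℤ → Set ℂ :=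
    fun p => {z | ⌊z.re * (8 * 2 ^ k)⌋ = p.1} ∩ {z | ⌊z.im * (8 * 2 ^ k)⌋ = p.2} with hQ
  have hQm : ∀ p, MeasurableSet (Q p) := fun p =>
    ((Int.measurable_floor.comp (Complex.measurable_re.mul_const _))
      (measurableSet_singleton p.1)).inter
      ((Int.measurable_floor.comp (Complex.measurable_im.mul_const _))
        (measurableSet_singleton p.2))
  have hpatch : ∀ p, logMeasure (farPiece τ u k ∩ Q p ∩ f ⁻¹' Y) ≤
      ENNReal.ofReal (8 / (c * 4096 ^ k)) * logMeasure Y := by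
    intro p
    rcases (farPiece τ u k ∩ Q p).eq_empty_or_nonempty with he | ⟨z₀, hz₀, hz₀Q⟩
    · simp [he]
    have hsub : farPiece τ u k ∩ Q p ⊆ ball z₀ ((2 ^ k)⁻¹ / 2) := by
      rintro z ⟨-, hz⟩
      rw [mem_ball_iff_norm]
      have h1 : |(z - z₀).re| * (8 * 2 ^ k) ≤ 1 := by
        rw [← abs_of_pos (show (0 : ℝ) < 8 * 2 ^ k by positivity), ← abs_mul, Complex.sub_re,
          sub_mul]
        exact (Int.abs_sub_lt_one_of_floor_eq_floor (hz.1.trans hz₀Q.1.symm)).le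
      have h2 : |(z - z₀).im| * (8 * 2 ^ k) ≤ 1 := by
        rw [← abs_of_pos (show (0 : ℝ) < 8 * 2 ^ k by positivity), ← abs_mul, Complex.sub_im,
          sub_mul]
        exact (Int.abs_sub_lt_one_of_floor_eq_floor (hz.2.trans hz₀Q.2.symm)).le
      rw [← le_div_iff₀ (by positivity)] at h1 h2
      have h3 : (1 : ℝ) / (8 * 2 ^ k) = (2 ^ k)⁻¹ / 8 := by field_simp
      rw [h3] at h1 h2
      have : (0 : ℝ) < (2 ^ k)⁻¹ := by positivity
      linarith [Complex.norm_le_abs_re_add_abs_im (z - z₀)]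
    refine (logMeasure_inter_preimage_le h.differentiable
      (fun z hz => (h.norm_logDeriv_sub_le_of_mem_farPiece hk hz₀ hz).1)
      (fun z hz => (h.norm_logDeriv_sub_le_of_mem_farPiece hk hz₀ hz).2) (by positivity)
      (h.two_le_norm_logDeriv_mul hk hz₀) (a := 16 ^ k) (by positivity)
      ((measurableSet_farPiece τ u k).inter (hQm p)) hsub (fun z hz => hz.1.1.1) hY).trans
      (mul_le_mul_left (ENNReal.ofReal_le_ofReal ?_) _)
    have h4 := h.le_norm_logDeriv_of_mem_farPiece hk hz₀
    calc 8 * ((2 ^ k)⁻¹ / 2) / ((16 ^ k) ^ 2 * ‖deriv f z₀ / f z₀‖)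
        ≤ 8 * ((2 ^ k)⁻¹ / 2) / ((16 ^ k) ^ 2 * (c * 8 ^ k / 2)) := by gcongr
      _ = 8 / (c * 4096 ^ k) := by
          have e8 : (8 : ℝ) ^ k = (2 ^ k) ^ 3 := by rw [← pow_mul, mul_comm, pow_mul]; norm_num
          have e16 : (16 : ℝ) ^ k = (2 ^ k) ^ 4 := by rw [← pow_mul, mul_comm k, pow_mul]; norm_num
          have e4096 : (4096 : ℝ) ^ k = (2 ^ k) ^ 12 := by
            rw [← pow_mul, mul_comm k, pow_mul]; norm_num
          rw [e8, e16, e4096]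
          field_simp
  have hcov : farPiece τ u k ∩ f ⁻¹' Y ⊆ ⋃ p ∈ F, farPiece τ u k ∩ Q p ∩ f ⁻¹' Y := by
    rintro z ⟨hz, hzY⟩
    have h1 : ∀ x : ℝ, |x| ≤ ‖z‖ → ⌊x * (8 * 2 ^ k)⌋ ∈ Finset.Icc (-(N : ℤ)) N := by
      intro x hx
      have h2 : |x * (8 * 2 ^ k)| ≤ N := by
        have e32 : (32 : ℝ) ^ k = 16 ^ k * 2 ^ k := by rw [← mul_pow]; norm_num
        have h3 := hz.1.2
        rw [pow_succ] at h3
        rw [abs_mul, abs_of_pos (show (0 : ℝ) < 8 * 2 ^ k by positivity), hN]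
        push_cast
        rw [e32]
        have : (0 : ℝ) < 2 ^ k := by positivity
        nlinarith
      rw [abs_le] at h2
      rw [Finset.mem_Icc, Int.le_floor]
      refine ⟨by push_cast; exact h2.1, ?_⟩
      exact_mod_cast (Int.floor_le _).trans h2.2
    simp only [mem_iUnion, exists_prop]
    exact ⟨(⌊z.re * (8 * 2 ^ k)⌋, ⌊z.im * (8 * 2 ^ k)⌋), Finset.mem_product.2
      ⟨h1 _ (Complex.abs_re_le_norm z), h1 _ (Complex.abs_im_le_norm z)⟩, ⟨hz, rfl, rfl⟩, hzY⟩
  calc logMeasure (farPiece τ u k ∩ f ⁻¹' Y)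
      ≤ ∑ p ∈ F, logMeasure (farPiece τ u k ∩ Q p ∩ f ⁻¹' Y) :=
        (measure_mono hcov).trans (measure_biUnion_finset_le _ _)
    _ ≤ ∑ p ∈ F, ENNReal.ofReal (8 / (c * 4096 ^ k)) * logMeasure Y :=
        Finset.sum_le_sum fun p _ => hpatch p
    _ = ENNReal.ofReal (F.card * (8 / (c * 4096 ^ k))) * logMeasure Y := by
        rw [Finset.sum_const, nsmul_eq_mul, ENNReal.ofReal_mul (by positivity),
          ENNReal.ofReal_natCast, mul_assoc]
    _ ≤ _ := by
        refine mul_le_mul_left (ENNReal.ofReal_le_ofReal ?_) _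
        calc _ ≤ (257 * 32 ^ k) ^ 2 * (8 / (c * 4096 ^ k)) := by gcongr
          _ = _ := by
            have e32 : (32 : ℝ) ^ k = (2 ^ k) ^ 5 := by
              rw [← pow_mul, mul_comm k, pow_mul]; norm_num
            have e4 : (4 : ℝ) ^ k = (2 ^ k) ^ 2 := by rw [← pow_mul, mul_comm k, pow_mul]; norm_num
            have e4096 : (4096 : ℝ) ^ k = (2 ^ k) ^ 12 := by
              rw [← pow_mul, mul_comm k, pow_mul]; norm_num
            rw [one_div, inv_pow (4 : ℝ) k, e32, e4096, e4]
            field_simp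

end LatticeGrowth

theorem LatticeGrowth.exp_le_norm {τ u : ℂ} {f : ℂ → ℂ} {C c : ℝ} (h : LatticeGrowth τ u f C c)
    {D : ℝ} {k : ℕ} (hk : D + 1 + 1 / c ≤ c * 4 ^ k) {z : ℂ} (hz : z ∈ farPiece τ u k) :
    Real.exp (D * 16 ^ k) ≤ ‖f z‖ := by
  have hc := h.pos
  have h2 : (1 : ℝ) ≤ 2 ^ k := one_le_pow₀ (by norm_num)
  have h16 : (1 : ℝ) ≤ 16 ^ k := one_le_pow₀ (by norm_num)
  have e64 : (64 : ℝ) ^ k = 4 ^ k * 16 ^ k := by rw [← mul_pow]; norm_num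
  have hsq : (64 : ℝ) ^ k ≤ (u * z).re ^ 2 := by
    rw [← sq_abs (u * z).re]
    calc (64 : ℝ) ^ k = (8 ^ k) ^ 2 := by rw [← pow_mul, mul_comm k, pow_mul]; norm_num
      _ ≤ _ := by gcongr; exact hz.2.2
  have h3 : 1 / c * 2 ^ k ≤ Real.exp ((1 + 1 / c) * 16 ^ k) := by
    have h4 : (2 : ℝ) ^ k ≤ Real.exp (16 ^ k) := by
      have h5 : (2 : ℝ) ^ k ≤ 16 ^ k := by gcongr; norm_num
      linarith [Real.add_one_le_exp ((16 : ℝ) ^ k)]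
    have h6 : 1 / c ≤ Real.exp (1 / c * 16 ^ k) := by
      have h7 : 1 / c ≤ 1 / c * 16 ^ k := le_mul_of_one_le_right (by positivity) h16
      linarith [Real.add_one_le_exp (1 / c * 16 ^ k)]
    rw [add_mul, one_mul, Real.exp_add, mul_comm]
    gcongr
  refine le_trans ?_ (h.le_norm _ (by positivity) (inv_le_one_of_one_le₀ h2) z hz.2.1)
  calc Real.exp (D * 16 ^ k)
      = c * (2 ^ k)⁻¹ * (1 / c * 2 ^ k * Real.exp (D * 16 ^ k)) := by field_simp
    _ ≤ c * (2 ^ k)⁻¹ * (Real.exp ((1 + 1 / c) * 16 ^ k) * Real.exp (D * 16 ^ k)) := by gcongr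
    _ = c * (2 ^ k)⁻¹ * Real.exp ((D + 1 + 1 / c) * 16 ^ k) := by rw [← Real.exp_add]; ring_nf
    _ ≤ c * (2 ^ k)⁻¹ * Real.exp (c * 4 ^ k * 16 ^ k) := by gcongr
    _ = c * (2 ^ k)⁻¹ * Real.exp (c * 64 ^ k) := by rw [e64, ← mul_assoc c (4 ^ k)]
    _ ≤ _ := by gcongr

theorem LatticeGrowth.volume_pos {τ u : ℂ} {f : ℂ → ℂ} {C c : ℝ} (h : LatticeGrowth τ u f C c)
    (hτ : 0 < τ.im) {a : ℂ} (ha : f a ≠ 0) : 0 < volume (juliaSet f ∩ fastEscapingSet f) := by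
  have hc := h.pos
  have hC := h.one_le
  have h0 : f 0 = 0 := by simpa [latticePoint] using h.apply_latticePoint (0, 0)
  have h1 : f 1 = 0 := by simpa [latticePoint] using h.apply_latticePoint (1, 0)
  obtain ⟨R₀, -, hR₀⟩ := exists_forall_lt_maxMod h.differentiable h0 h1 ha
  obtain ⟨B, hB0, hB⟩ := exists_logMeasure_annulus_diff_farPiece_le hτ h.norm_eq_one
  set κ := 1 + ‖τ‖ with hκ
  have hκ0 : 0 < κ := by positivity
  set D := 34 * C + 48 * κ + 32 with hD
  set b := 257 ^ 2 * 8 / c with hb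
  have hb0 : 0 < b := by positivity
  set X := (D + 1 + 1 / c) / c + 4 * b + max R₀ 1 ^ 2 with hX
  obtain ⟨K, hK⟩ := pow_unbounded_of_one_lt X (by norm_num : (1 : ℝ) < 2)
  have hXk : ∀ k, X ≤ 2 ^ (K + k) := fun k =>
    hK.le.trans (pow_le_pow_right₀ (by norm_num) (by omega))
  have hX1 : 0 ≤ (D + 1 + 1 / c) / c := by positivity
  have hX2 : 0 ≤ max R₀ 1 ^ 2 := by positivity
  have hDk : ∀ k, D + 1 + 1 / c ≤ c * 4 ^ (K + k) := fun k => by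
    have h2 : (2 : ℝ) ^ (K + k) ≤ 4 ^ (K + k) := by gcongr; norm_num
    have h3 : (D + 1 + 1 / c) / c ≤ 4 ^ (K + k) := by linarith [hXk k]
    rwa [div_le_iff₀' hc] at h3
  have hc1 : 0 ≤ 1 / c := by positivity
  have hCk : ∀ k, 8 * C ≤ c * 4 ^ (K + k) := fun k => by linarith [hDk k]
  have h16 : ∀ k : ℕ, (1 : ℝ) ≤ 16 ^ k := fun k => one_le_pow₀ (by norm_num)
  have hGm : MeasurableSet (⋃ k, farPiece τ u (K + k)) :=
    MeasurableSet.iUnion fun k => measurableSet_farPiece τ u _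
  refine volume_juliaSet_inter_fastEscapingSet_pos h.differentiable h0
    (Λ := range (latticePoint τ)) (κ := κ) (by rintro _ ⟨q, rfl⟩; exact h.apply_latticePoint q)
    (fun z => ?_) h.one_le h.norm_le (le_max_right R₀ 1)
    (fun r hr => hR₀ r ((le_max_left _ _).trans hr)) (R := 16 ^ K) ?_ hGm ?_ ?_ ?_ ?_
    (logMeasure_norm_ge_eq_top _) ?_
  · obtain ⟨q, hq⟩ := exists_latticePoint_near hτ z
    exact ⟨_, mem_range_self q, hq⟩
  · have h2 : (2 : ℝ) ^ K ≤ 16 ^ K := by gcongr; norm_num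
    linarith
  · intro z hz
    obtain ⟨k, hk⟩ := mem_iUnion.1 hz
    exact (pow_le_pow_right₀ (by norm_num) (by omega)).trans hk.1.1
  · intro z hz
    obtain ⟨k, hk⟩ := mem_iUnion.1 hz
    refine le_trans ?_ (h.exp_le_norm (hDk k) hk)
    rw [Real.exp_le_exp, hD]
    have h3 := hk.1.2.le
    rw [pow_succ] at h3
    have h4 : 2 * C * (1 + ‖z‖) ≤ 2 * C * (17 * 16 ^ (K + k)) := by
      gcongr
      linarith [h16 (K + k)]
    have h5 : 0 ≤ (48 * κ + 32) * 16 ^ (K + k) := by positivity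
    linarith
  · intro z hz w hw
    obtain ⟨k, hk⟩ := mem_iUnion.1 hz
    have hbig : 48 * κ + 32 ≤ ‖f z‖ := by
      have h3 := h.exp_le_norm (hDk k) hk
      have h4 := Real.add_one_le_exp (D * 16 ^ (K + k))
      have h5 : D * 1 ≤ D * 16 ^ (K + k) := by gcongr; exact h16 _
      linarith
    have hl : 1 ≤ ‖deriv f z / f z‖ := by
      refine le_trans ?_ (h.le_norm_logDeriv_of_mem_farPiece (hCk k) hk)
      have h3 : c * (4 : ℝ) ^ (K + k) ≤ c * 8 ^ (K + k) := by gcongr; norm_num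
      linarith [hCk k]
    refine exists_preimage_near h.differentiable
      (fun y hy => (h.norm_logDeriv_sub_le_of_mem_farPiece (hCk k) hk hy).1)
      (fun y hy => (h.norm_logDeriv_sub_le_of_mem_farPiece (hCk k) hk hy).2) (by positivity)
      (h.two_le_norm_logDeriv_mul (hCk k) hk) ?_ (by linarith)
    nlinarith
  · refine ne_top_of_le_ne_top ?_ (measure_mono (t := ⋃ k : ℕ,
      {z | 16 ^ k ≤ ‖z‖ ∧ ‖z‖ < 16 ^ (k + 1)} \ farPiece τ u k) ?_)
    · refine ne_top_of_le_ne_top ?_ ((measure_iUnion_le _).trans (ENNReal.tsum_le_tsum hB))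
      exact (summable_geometric_two.mul_left B).tsum_ofReal_ne_top
    · rintro z ⟨hz, hzG⟩
      have hz : (16 : ℝ) ^ K ≤ ‖z‖ := hz
      obtain ⟨n, hn⟩ := exists_nat_pow_near ((h16 K).trans hz) (by norm_num : (1 : ℝ) < 16)
      have hKn : K < n + 1 :=
        (pow_lt_pow_iff_right₀ (by norm_num : (1 : ℝ) < 16)).1 (hz.trans_lt hn.2)
      refine mem_iUnion.2 ⟨n, hn, fun hmem => hzG (mem_iUnion.2 ⟨n - K, ?_⟩)⟩
      rwa [Nat.add_sub_cancel' (by omega)]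
  · intro Y hY
    rw [iUnion_inter]
    calc logMeasure (⋃ k, farPiece τ u (K + k) ∩ f ⁻¹' Y)
        ≤ ∑' k, logMeasure (farPiece τ u (K + k) ∩ f ⁻¹' Y) := measure_iUnion_le _
      _ ≤ ∑' k : ℕ, ENNReal.ofReal (1 / 4 * (1 / 2) ^ k) * logMeasure Y := by
          refine ENNReal.tsum_le_tsum fun k =>
            (h.logMeasure_farPiece_inter_preimage_le (hCk k) hY).trans
              (mul_le_mul_left (ENNReal.ofReal_le_ofReal ?_) _)
          have h3 : 4 * b ≤ 2 ^ (K + k) := by linarith [hXk k]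
          have h4 : ((1 : ℝ) / 4) ^ (K + k) = (1 / 2) ^ (K + k) * (1 / 2) ^ (K + k) := by
            rw [← mul_pow]; norm_num
          have h5 : ((1 : ℝ) / 2) ^ (K + k) ≤ (1 / 2) ^ k :=
            pow_le_pow_of_le_one (by norm_num) (by norm_num) (by omega)
          have h6 : (2 : ℝ) ^ (K + k) * (1 / 2) ^ (K + k) = 1 := by rw [← mul_pow]; norm_num
          calc b * (1 / 4) ^ (K + k) = 1 / 4 * (4 * b * (1 / 2) ^ (K + k)) * (1 / 2) ^ (K + k) := by
                rw [h4]; ring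
            _ ≤ 1 / 4 * (2 ^ (K + k) * (1 / 2) ^ (K + k)) * (1 / 2) ^ k := by gcongr
            _ = _ := by rw [h6, mul_one]
      _ = 2⁻¹ * logMeasure Y := by
          rw [ENNReal.tsum_mul_right, ← ENNReal.ofReal_tsum_of_nonneg (fun k => by positivity)
            (summable_geometric_two.mul_left _), tsum_mul_left, tsum_geometric_two]
          congr 1
          rw [show (1 : ℝ) / 4 * 2 = 2⁻¹ by norm_num, ENNReal.ofReal_inv_of_pos (by norm_num),
            ENNReal.ofReal_ofNat]

/-- The Weierstrass primary factor of genus two. -/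
noncomputable def primaryFactor (u : ℂ) : ℂ := (1 - u) * Complex.exp (u + u ^ 2 / 2)

theorem hasDerivAt_primaryFactor (u : ℂ) :
    HasDerivAt primaryFactor (-u ^ 2 * Complex.exp (u + u ^ 2 / 2)) u := by
  have h1 : HasDerivAt (fun u : ℂ => u + u ^ 2 / 2) (1 + u) u := by
    convert! (hasDerivAt_id u).add ((hasDerivAt_pow 2 u).div_const 2) using 1
    simp
  convert! ((hasDerivAt_id u).const_sub 1).mul h1.cexp using 1
  simp
  ring

theorem norm_primaryFactor_sub_one_le {u : ℂ} (hu : ‖u‖ ≤ 1) :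
    ‖primaryFactor u - 1‖ ≤ 5 * ‖u‖ ^ 3 := by
  have h := (convex_closedBall (0 : ℂ) ‖u‖).norm_image_sub_le_of_norm_hasDerivWithin_le
    (f := primaryFactor) (C := 5 * ‖u‖ ^ 2) (x := 0) (y := u)
    (fun x _ => (hasDerivAt_primaryFactor x).hasDerivWithinAt) ?_ (by simp) (by simp)
  · simpa [primaryFactor, pow_succ, mul_assoc] using h
  · intro x hx
    rw [mem_closedBall_zero_iff] at hx
    rw [norm_mul, norm_neg, norm_pow, mul_comm]
    refine mul_le_mul ?_ (by gcongr) (by positivity) (by norm_num)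
    have h1 : ‖x + x ^ 2 / 2‖ ≤ 3 / 2 := by
      refine (norm_add_le _ _).trans ?_
      rw [norm_div, norm_pow]
      have := norm_nonneg x
      norm_num
      nlinarith
    refine (Complex.norm_exp_le_exp_norm _).trans ((Real.exp_le_exp.2 h1).trans ?_)
    have h2 := Real.exp_one_lt_d9
    have h3 : Real.exp (3 / 2) ^ 2 = Real.exp 1 ^ 3 := by
      rw [← Real.exp_nat_mul, ← Real.exp_nat_mul]; norm_num
    have h4 : Real.exp 1 ^ 3 ≤ 2.72 ^ 3 := by gcongr; linarith
    refine le_of_sq_le_sq ?_ (by norm_num)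
    rw [h3]; norm_num at h4 ⊢; linarith

theorem primaryFactor_eq_zero_iff {u : ℂ} : primaryFactor u = 0 ↔ u = 1 := by
  rw [primaryFactor, mul_eq_zero, or_iff_left (Complex.exp_ne_zero _), sub_eq_zero, eq_comm]

theorem latticePoint_zero (τ : ℂ) : latticePoint τ 0 = 0 := by simp [latticePoint]

theorem latticePoint_add (τ : ℂ) (p q : ℤ × ℤ) :
    latticePoint τ (p + q) = latticePoint τ p + latticePoint τ q := by
  simp [latticePoint]; ring

theorem latticePoint_neg (τ : ℂ) (q : ℤ × ℤ) : latticePoint τ (-q) = -latticePoint τ q := by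
  simp [latticePoint]; ring

theorem latticePoint_sub (τ : ℂ) (p q : ℤ × ℤ) :
    latticePoint τ (p - q) = latticePoint τ p - latticePoint τ q := by
  rw [sub_eq_add_neg, latticePoint_add, latticePoint_neg, ← sub_eq_add_neg]

theorem latticePoint_eq_zero_iff {τ : ℂ} (hτ : 0 < τ.im) {q : ℤ × ℤ} :
    latticePoint τ q = 0 ↔ q = 0 := by
  refine ⟨fun h => ?_, fun h => h ▸ latticePoint_zero τ⟩
  have h1 := abs_le_mul_norm_latticePoint hτ q
  rw [h] at h1
  simp only [norm_zero, mul_zero, abs_nonpos_iff, Int.cast_eq_zero] at h1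
  exact Prod.ext h1.1 h1.2

theorem latticePoint_injective {τ : ℂ} (hτ : 0 < τ.im) : Function.Injective (latticePoint τ) :=
  fun p q h => sub_eq_zero.1 ((latticePoint_eq_zero_iff hτ).1 (by
    rw [latticePoint_sub, h, sub_self]))

theorem summable_inv_norm_latticePoint_pow {τ : ℂ} (hτ : 0 < τ.im) :
    Summable fun q => (‖latticePoint τ q‖ ^ 3)⁻¹ := by
  have h := (finTwoArrowEquiv ℤ).symm.summable_iff.2
    (EisensteinSeries.summable_one_div_norm_rpow (k := 3) (by norm_num))
  set K := 1 + (1 + ‖τ‖) / τ.im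
  refine (h.mul_left (K ^ 3)).of_nonneg_of_le (fun q => by positivity) fun q => ?_
  by_cases hq : q = 0
  · rw [hq, latticePoint_zero]
    simp only [norm_zero]
    norm_num
    positivity
  have h1 := abs_le_mul_norm_latticePoint hτ q
  have h2 : 0 < ‖latticePoint τ q‖ :=
    norm_pos_iff.2 fun h => hq ((latticePoint_eq_zero_iff hτ).1 h)
  have h3 : ‖(finTwoArrowEquiv ℤ).symm q‖ ≤ K * ‖latticePoint τ q‖ := by
    rw [pi_norm_le_iff_of_nonneg (by positivity)]
    intro i
    fin_cases i
    · simpa [Int.norm_eq_abs] using h1.1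
    · simpa [Int.norm_eq_abs] using h1.2
  have h4 : 0 < ‖(finTwoArrowEquiv ℤ).symm q‖ := by
    refine norm_pos_iff.2 fun h => hq ?_
    have := congrArg (finTwoArrowEquiv ℤ) h
    simpa [← Prod.zero_eq_mk] using this
  simp only [Function.comp]
  rw [Real.rpow_neg h4.le, show (3 : ℝ) = ((3 : ℕ) : ℝ) by norm_num, Real.rpow_natCast,
    ← div_eq_mul_inv, le_div_iff₀ (by positivity), inv_mul_le_iff₀ (by positivity), ← mul_pow,
    mul_comm ‖latticePoint τ q‖ K]
  gcongr

theorem finite_norm_latticePoint_le {τ : ℂ} (hτ : 0 < τ.im) (R : ℝ) :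
    {q | ‖latticePoint τ q‖ ≤ R}.Finite := by
  have h := (summable_inv_norm_latticePoint_pow hτ).tendsto_cofinite_zero
  have h1 := h.eventually (gt_mem_nhds (show (0 : ℝ) < ((|R| + 1) ^ 3)⁻¹ by positivity))
  refine (Set.Finite.insert (0 : ℤ × ℤ) h1).subset fun q hq => ?_
  by_cases hq0 : q = 0
  · exact Or.inl hq0
  right
  have h2 : 0 < ‖latticePoint τ q‖ :=
    norm_pos_iff.2 (fun h => hq0 ((latticePoint_eq_zero_iff hτ).1 h))
  simp only [mem_compl_iff, mem_ofPred_eq, not_lt]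
  have : ‖latticePoint τ q‖ ≤ |R| + 1 := (show _ ≤ R from hq).trans (by linarith [le_abs_self R])
  gcongr

/-- The canonical product over the nonzero lattice points. The factor of index `0` is `1`, as
`z / 0 = 0`. -/
noncomputable def latticeProd (τ z : ℂ) : ℂ := ∏' q : ℤ × ℤ, primaryFactor (z / latticePoint τ q)

theorem wSigma_eq_mul_latticeProd (τ z : ℂ) : wSigma τ z = z * latticeProd τ z := by
  rw [wSigma, latticeProd]
  congr 1
  rw [← tprod_subtype_eq_of_mulSupport_subset (s := {q : ℤ × ℤ | q ≠ (0, 0)})]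
  · refine tprod_congr fun q => ?_
    simp only [primaryFactor, div_pow]
    congr 3
    rw [div_div, mul_comm]
  · intro q hq
    rw [Function.mem_mulSupport] at hq
    rintro rfl
    exact hq (by simp [latticePoint, primaryFactor])

theorem norm_primaryFactor_div_sub_one_le {τ z : ℂ} {ρ : ℝ} {q : ℤ × ℤ} (hz : ‖z‖ ≤ ρ)
    (hq : ρ < ‖latticePoint τ q‖) :
    ‖primaryFactor (z / latticePoint τ q) - 1‖ ≤ 5 * ρ ^ 3 * (‖latticePoint τ q‖ ^ 3)⁻¹ := by
  have h0 : 0 < ‖latticePoint τ q‖ := (norm_nonneg z).trans_lt (hz.trans_lt hq)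
  refine (norm_primaryFactor_sub_one_le ?_).trans ?_
  · rw [norm_div, div_le_one h0]
    linarith
  · rw [norm_div, div_pow, mul_assoc, div_eq_mul_inv]
    gcongr

theorem multipliableLocallyUniformlyOn_primaryFactor {τ : ℂ} (hτ : 0 < τ.im) (ρ : ℝ) :
    MultipliableLocallyUniformlyOn
      (fun q z => primaryFactor (z / latticePoint τ q)) (ball 0 ρ) := by
  have h := ((summable_inv_norm_latticePoint_pow hτ).mul_left
    (5 * ρ ^ 3)).multipliableLocallyUniformlyOn_one_add (K := ball (0 : ℂ) ρ)
    (f := fun q z => primaryFactor (z / latticePoint τ q) - 1) isOpen_ball ?_ ?_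
  · simpa using h
  · refine (finite_norm_latticePoint_le hτ ρ).subset fun q hq => ?_
    simp only [mem_compl_iff, mem_ofPred_eq] at hq ⊢
    by_contra! hc
    exact hq fun z hz => norm_primaryFactor_div_sub_one_le (mem_ball_zero_iff.1 hz).le hc
  · intro q
    have : Continuous primaryFactor := by unfold primaryFactor; fun_prop
    fun_prop

theorem differentiable_primaryFactor : Differentiable ℂ primaryFactor :=
  fun u => (hasDerivAt_primaryFactor u).differentiableAt

theorem differentiable_latticeProd {τ : ℂ} (hτ : 0 < τ.im) : Differentiable ℂ (latticeProd τ) := by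
  intro z
  have h := (multipliableLocallyUniformlyOn_primaryFactor hτ (‖z‖ + 1)).hasProdLocallyUniformlyOn
  rw [hasProdLocallyUniformlyOn_iff_tendstoLocallyUniformlyOn] at h
  refine (h.differentiableOn (.of_forall fun s => ?_) isOpen_ball).differentiableAt
    (isOpen_ball.mem_nhds (mem_ball_zero_iff.2 (lt_add_one _)))
  have := differentiable_primaryFactor
  fun_prop

theorem latticeProd_ne_zero {τ z : ℂ} (hτ : 0 < τ.im) (hz : ∀ q ≠ 0, z ≠ latticePoint τ q) :
    latticeProd τ z ≠ 0 := by
  have h := tprod_one_add_ne_zero_of_summable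
    (f := fun q => primaryFactor (z / latticePoint τ q) - 1) (fun q => ?_) ?_
  · simpa [latticeProd] using h
  · rw [add_sub_cancel, Ne, primaryFactor_eq_zero_iff]
    intro h
    have h1 : latticePoint τ q ≠ 0 := fun h1 => by simp [h1] at h
    exact hz q (fun h2 => h1 (h2 ▸ latticePoint_zero τ)) ((div_eq_one_iff_eq h1).1 h)
  · refine Summable.of_norm_bounded_eventually ((summable_inv_norm_latticePoint_pow hτ).mul_left
      (5 * ‖z‖ ^ 3)) ?_
    refine (finite_norm_latticePoint_le hτ ‖z‖).subset fun q hq => ?_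
    simp only [mem_compl_iff, mem_ofPred_eq, norm_norm] at hq ⊢
    by_contra! hc
    exact hq (norm_primaryFactor_div_sub_one_le le_rfl hc)

theorem wSigma_latticePoint (τ : ℂ) (q : ℤ × ℤ) : wSigma τ (latticePoint τ q) = 0 := by
  by_cases hq : latticePoint τ q = 0
  · rw [hq, wSigma, zero_mul]
  · rw [wSigma_eq_mul_latticeProd, latticeProd, tprod_of_exists_eq_zero, mul_zero]
    exact ⟨q, by rw [div_self hq, primaryFactor_eq_zero_iff]⟩

theorem wSigma_ne_zero {τ z : ℂ} (hτ : 0 < τ.im) (hz : ∀ q, z ≠ latticePoint τ q) :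
    wSigma τ z ≠ 0 := by
  rw [wSigma_eq_mul_latticeProd]
  exact mul_ne_zero (latticePoint_zero τ ▸ hz 0) (latticeProd_ne_zero hτ fun q _ => hz q)

theorem differentiable_wSigma {τ : ℂ} (hτ : 0 < τ.im) : Differentiable ℂ (wSigma τ) := by
  have h := differentiable_latticeProd hτ
  rw [show wSigma τ = fun z => z * latticeProd τ z from funext (wSigma_eq_mul_latticeProd τ)]
  fun_prop

theorem wSigma_neg (τ z : ℂ) : wSigma τ (-z) = -wSigma τ z := by
  rw [wSigma_eq_mul_latticeProd, wSigma_eq_mul_latticeProd, neg_mul]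
  congr 2
  rw [latticeProd, ← (Equiv.neg (ℤ × ℤ)).tprod_eq]
  simp [latticeProd, latticePoint_neg]

theorem wZeta_neg {τ : ℂ} (z : ℂ) : wZeta τ (-z) = -wZeta τ z := by
  have h : (fun w => wSigma τ (-w)) = fun w => -wSigma τ w := funext (wSigma_neg τ)
  have h1 := congrArg (fun f => deriv f z) h
  simp only [deriv_comp_neg, deriv.fun_neg, neg_inj] at h1
  rw [wZeta, wZeta, wSigma_neg, h1, div_neg]

theorem logDeriv_primaryFactor_div {z ω : ℂ} (hz : z ≠ ω) :
    logDeriv (fun z => primaryFactor (z / ω)) z = z ^ 2 / (ω ^ 2 * (z - ω)) := by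
  by_cases hω : ω = 0
  · simp [hω]
  have hd : HasDerivAt (fun z : ℂ => z / ω) (1 / ω) z := (hasDerivAt_id z).div_const ω
  have h : HasDerivAt (fun z => primaryFactor (z / ω)) _ z :=
    HasDerivAt.comp (h := fun z => z / ω) z (hasDerivAt_primaryFactor (z / ω)) hd
  rw [logDeriv_apply, h.deriv, primaryFactor]
  have h2 : 1 - z / ω ≠ 0 := by
    rw [sub_ne_zero]; intro h; exact hz ((div_eq_one_iff_eq hω).1 h.symm)
  rw [show -(z / ω) ^ 2 * Complex.exp (z / ω + (z / ω) ^ 2 / 2) * (1 / ω) /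
    ((1 - z / ω) * Complex.exp (z / ω + (z / ω) ^ 2 / 2)) = -(z / ω) ^ 2 * (1 / ω) / (1 - z / ω) by
    field_simp]
  rw [div_eq_div_iff h2 (by positivity)]
  field_simp
  ring

theorem summable_logDeriv_primaryFactor {τ : ℂ} (hτ : 0 < τ.im) (z : ℂ) :
    Summable fun q => z ^ 2 / (latticePoint τ q ^ 2 * (z - latticePoint τ q)) := by
  refine Summable.of_norm_bounded_eventually ((summable_inv_norm_latticePoint_pow hτ).mul_left
    (2 * ‖z‖ ^ 2)) ?_
  refine (finite_norm_latticePoint_le hτ (2 * ‖z‖)).subset fun q hq => ?_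
  simp only [mem_compl_iff, mem_ofPred_eq] at hq ⊢
  by_contra! hc
  refine hq ?_
  have h0 : 0 < ‖latticePoint τ q‖ := by linarith [norm_nonneg z]
  have h1 := norm_sub_norm_le (latticePoint τ q) z
  rw [norm_sub_rev] at h1
  rw [norm_div, norm_mul, norm_pow, norm_pow, ← div_eq_mul_inv,
    show 2 * ‖z‖ ^ 2 / ‖latticePoint τ q‖ ^ 3 =
      ‖z‖ ^ 2 / (‖latticePoint τ q‖ ^ 2 * (‖latticePoint τ q‖ / 2)) by field_simp]
  gcongr
  linarith

theorem wZeta_eq_add_logDeriv {τ z : ℂ} (hτ : 0 < τ.im) (hz : ∀ q, z ≠ latticePoint τ q) :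
    wZeta τ z = 1 / z + deriv (latticeProd τ) z / latticeProd τ z := by
  have h1 : z ≠ 0 := latticePoint_zero τ ▸ hz 0
  have h2 := latticeProd_ne_zero hτ fun q _ => hz q
  have h3 : HasDerivAt (wSigma τ) (1 * latticeProd τ z + z * deriv (latticeProd τ) z) z := by
    rw [show wSigma τ = fun z => z * latticeProd τ z from funext (wSigma_eq_mul_latticeProd τ)]
    exact (hasDerivAt_id z).mul (differentiable_latticeProd hτ z).hasDerivAt
  rw [wZeta, h3.deriv, wSigma_eq_mul_latticeProd]
  field_simp

theorem wZeta_eq_tsum {τ z : ℂ} (hτ : 0 < τ.im) (hz : ∀ q, z ≠ latticePoint τ q) :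
    wZeta τ z = 1 / z + ∑' q, z ^ 2 / (latticePoint τ q ^ 2 * (z - latticePoint τ q)) := by
  rw [wZeta_eq_add_logDeriv hτ hz, ← logDeriv_apply]
  have h := logDeriv_tprod_eq_tsum (x := z)
    (f := fun q z => primaryFactor (z / latticePoint τ q)) isOpen_ball
    (mem_ball_zero_iff.2 (lt_add_one ‖z‖)) (fun q => ?_) (fun q => ?_) ?_
    (multipliableLocallyUniformlyOn_primaryFactor hτ _) (latticeProd_ne_zero hτ fun q _ => hz q)
  · rw [show latticeProd τ = fun z => ∏' q, primaryFactor (z / latticePoint τ q) from rfl, h]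
    simp_rw [fun q => logDeriv_primaryFactor_div (hz q)]
  · rw [Ne, primaryFactor_eq_zero_iff]
    intro h
    have h1 : latticePoint τ q ≠ 0 := fun h1 => by simp [h1] at h
    exact hz q ((div_eq_one_iff_eq h1).1 h)
  · have := differentiable_primaryFactor
    fun_prop
  · simp_rw [fun q => logDeriv_primaryFactor_div (hz q)]
    exact summable_logDeriv_primaryFactor hτ z

/-- The function `π cot (π x)`. -/
noncomputable def cotPi (x : ℂ) : ℂ := Real.pi * Complex.cot (Real.pi * x)

theorem cotPi_add_one (x : ℂ) : cotPi (x + 1) = cotPi x := by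
  simp [cotPi, Complex.cot, mul_add, Complex.sin_add_pi, Complex.cos_add_pi]

theorem cotPi_neg (x : ℂ) : cotPi (-x) = -cotPi x := by
  simp [cotPi, Complex.cot, div_neg]

theorem tendsto_cotPi {w : ℕ → ℂ} (hw : Tendsto (fun n => (w n).im) atTop atTop) :
    Tendsto (fun n => cotPi (w n)) atTop (𝓝 (-(Real.pi * Complex.I))) := by
  have h : Tendsto (fun n => Complex.exp (2 * Real.pi * Complex.I * w n)) atTop (𝓝 0) := by
    rw [tendsto_zero_iff_norm_tendsto_zero]
    simp only [Complex.norm_exp]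
    refine Real.tendsto_exp_atBot.comp ?_
    have := hw.const_mul_atTop_of_neg (show -(2 * Real.pi) < 0 by linarith [Real.pi_pos])
    refine this.congr fun n => ?_
    simp
  have h1 := ((h.add_const 1).div ((h.const_sub 1).const_mul Complex.I)
    (by simp)).const_mul (Real.pi : ℂ)
  simp only [cotPi, Complex.cot_pi_eq_exp_ratio]
  convert! h1 using 2
  simp

theorem hasSum_cotPi_sub {x y : ℂ} (hx : ∀ m : ℤ, x ≠ m) (hy : ∀ m : ℤ, y ≠ m)
    (hs : Summable fun m : ℤ => 1 / (x - m) - 1 / (y - m)) :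
    HasSum (fun m : ℤ => 1 / (x - m) - 1 / (y - m)) (cotPi x - cotPi y) := by
  have hx' : x ∈ Complex.integerComplement := fun ⟨m, hm⟩ => hx m hm.symm
  have hy' : y ∈ Complex.integerComplement := fun ⟨m, hm⟩ => hy m hm.symm
  have h1 := (hasSum_nat_add_iff' 1).2 hs.hasSum.nat_add_neg
  have h2 := (summable_cotTerm hx').hasSum.sub (summable_cotTerm hy').hasSum
  rw [← cot_series_rep' hx', ← cot_series_rep' hy'] at h2
  have h3 := h1.unique (h2.congr_fun ?_)
  · simp only [Finset.range_one, Finset.sum_singleton, Nat.cast_zero, neg_zero, Int.cast_zero,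
      sub_zero] at h3
    have h4 : ∑' m : ℤ, (1 / (x - m) - 1 / (y - m)) = cotPi x - cotPi y := by
      simp only [cotPi]
      linear_combination h3
    exact h4 ▸ hs.hasSum
  · intro n
    push_cast
    simp only [cotTerm]
    ring

theorem hasSum_wZeta_sub {τ z w : ℂ} (hτ : 0 < τ.im) (hz : ∀ q, z ≠ latticePoint τ q)
    (hw : ∀ q, w ≠ latticePoint τ q) :
    HasSum (fun q => 1 / (z - latticePoint τ q) - 1 / (w - latticePoint τ q) +
      (z - w) / latticePoint τ q ^ 2) (wZeta τ z - wZeta τ w) := by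
  have h := ((summable_logDeriv_primaryFactor hτ z).hasSum.sub
    (summable_logDeriv_primaryFactor hτ w).hasSum).add
    (hasSum_ite_eq (0 : ℤ × ℤ) (1 / z - 1 / w))
  convert! h using 1
  · ext q
    by_cases hq : q = 0
    · simp [hq, latticePoint_zero]
    · have h1 : latticePoint τ q ≠ 0 := fun h => hq ((latticePoint_eq_zero_iff hτ).1 h)
      have h2 := sub_ne_zero.2 (hz q)
      have h3 := sub_ne_zero.2 (hw q)
      rw [if_neg hq]
      field_simp
      ring
  · rw [wZeta_eq_tsum hτ hz, wZeta_eq_tsum hτ hw]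
    ring

/-- The sum of `1 / ω ^ 2` over the nonzero lattice points of a horizontal row. -/
noncomputable def rowSum (τ : ℂ) (n : ℤ) : ℂ := ∑' m : ℤ, 1 / latticePoint τ (m, n) ^ 2

theorem summable_row (τ : ℂ) (n : ℤ) : Summable fun m : ℤ => 1 / latticePoint τ (m, n) ^ 2 := by
  refine (EisensteinSeries.linear_right_summable τ n (k := 2) le_rfl).congr fun m => ?_
  rw [one_div, latticePoint, zpow_ofNat, add_comm]

theorem hasSum_rowSum_add_cotPi_sub {τ z w : ℂ} (hτ : 0 < τ.im) (hz : ∀ q, z ≠ latticePoint τ q)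
    (hw : ∀ q, w ≠ latticePoint τ q) :
    HasSum (fun n : ℤ => (cotPi (z - n * τ) - cotPi (w - n * τ)) + (z - w) * rowSum τ n)
      (wZeta τ z - wZeta τ w) := by
  have h := (Equiv.prodComm ℤ ℤ).hasSum_iff.2 (hasSum_wZeta_sub hτ hz hw)
  refine h.prod_fiberwise fun n => ?_
  have h1 := h.summable.prod_factor n
  have h2 := (summable_row τ n).mul_left (z - w)
  have h3 := (hasSum_cotPi_sub (x := z - n * τ) (y := w - n * τ)
    (fun m hm => hz (m, n) (by rw [latticePoint, ← hm]; ring))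
    (fun m hm => hw (m, n) (by rw [latticePoint, ← hm]; ring)) ?_).add h2.hasSum
  · rw [tsum_mul_left] at h3
    refine h3.congr_fun fun m => ?_
    simp only [Function.comp, Equiv.prodComm_apply, Prod.swap, latticePoint]
    ring
  · refine (h1.sub h2).congr fun m => ?_
    simp only [Function.comp, Equiv.prodComm_apply, Prod.swap, latticePoint]
    ring

theorem ne_latticePoint_add {τ z : ℂ} (hz : ∀ q, z ≠ latticePoint τ q) (p : ℤ × ℤ) (q : ℤ × ℤ) :
    z + latticePoint τ p ≠ latticePoint τ q := fun h =>
  hz (q - p) (by rw [latticePoint_sub, ← h, add_sub_cancel_right])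

theorem latticePoint_one_zero (τ : ℂ) : latticePoint τ (1, 0) = 1 := by simp [latticePoint]

theorem latticePoint_zero_one (τ : ℂ) : latticePoint τ (0, 1) = τ := by simp [latticePoint]

theorem hasSum_rowSum {τ z : ℂ} (hτ : 0 < τ.im) (hz : ∀ q, z ≠ latticePoint τ q) :
    HasSum (rowSum τ) (wZeta τ (z + 1) - wZeta τ z) := by
  have h := hasSum_rowSum_add_cotPi_sub hτ (latticePoint_one_zero τ ▸ ne_latticePoint_add hz (1, 0))
    hz
  refine h.congr_fun fun n => ?_
  rw [add_sub_right_comm, cotPi_add_one]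
  ring

theorem neg_half_ne_latticePoint {τ : ℂ} (hτ : 0 < τ.im) (q : ℤ × ℤ) :
    (-1 / 2 : ℂ) ≠ latticePoint τ q := by
  intro h
  have h1 : latticePoint τ (2 * q.1 + 1, 2 * q.2) = 0 := by
    have : latticePoint τ (2 * q.1 + 1, 2 * q.2) = 2 * latticePoint τ q + 1 := by
      simp [latticePoint]; ring
    rw [this, ← h]; ring
  rw [latticePoint_eq_zero_iff hτ, Prod.ext_iff] at h1
  have := h1.1
  simp at this
  omega

theorem hasSum_rowSum_wEta1 {τ : ℂ} (hτ : 0 < τ.im) : HasSum (rowSum τ) (wEta1 τ) := by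
  convert! hasSum_rowSum hτ (neg_half_ne_latticePoint hτ) using 1
  rw [show (-1 / 2 : ℂ) + 1 = 1 / 2 by norm_num, show (-1 / 2 : ℂ) = -(1 / 2) by norm_num,
    wZeta_neg, wEta1]
  ring

theorem wZeta_add_one {τ z : ℂ} (hτ : 0 < τ.im) (hz : ∀ q, z ≠ latticePoint τ q) :
    wZeta τ (z + 1) = wZeta τ z + wEta1 τ := by
  rw [← (hasSum_rowSum hτ hz).unique (hasSum_rowSum_wEta1 hτ)]; ring

theorem wZeta_add_tau {τ z : ℂ} (hτ : 0 < τ.im) (hz : ∀ q, z ≠ latticePoint τ q) :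
    wZeta τ (z + τ) = wZeta τ z + (wEta1 τ * τ - 2 * Real.pi * Complex.I) := by
  have h := (hasSum_rowSum_add_cotPi_sub hτ
    (latticePoint_zero_one τ ▸ ne_latticePoint_add hz (0, 1)) hz).sub
    ((hasSum_rowSum_wEta1 hτ).mul_left τ)
  have h1 := h.nat_add_neg_add_one.tendsto_sum_nat
  have h2 : ∀ N : ℕ, ∑ k ∈ Finset.range N,
      ((cotPi (z + τ - (k : ℤ) * τ) - cotPi (z - (k : ℤ) * τ) + (z + τ - z) * rowSum τ k -
        τ * rowSum τ k) + (cotPi (z + τ - ((-(k + 1) : ℤ) : ℂ) * τ) -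
          cotPi (z - ((-(k + 1) : ℤ) : ℂ) * τ) + (z + τ - z) * rowSum τ (-(k + 1)) -
        τ * rowSum τ (-(k + 1)))) =
      cotPi (z + (N + 1) * τ) + cotPi (-z + (N - 1) * τ) := by
    intro N
    induction N with
    | zero =>
      rw [Finset.sum_range_zero, show -z + ((0 : ℕ) - 1) * τ = -(z + ((0 : ℕ) + 1) * τ) by
        push_cast; ring, cotPi_neg]
      ring
    | succ N ih =>
      rw [Finset.sum_range_succ, ih,
        show -z + (N - 1) * τ = -(z + τ - (N : ℤ) * τ) by push_cast; ring,
        show -z + ((N + 1 : ℕ) - 1) * τ = -(z - (N : ℤ) * τ) by push_cast; ring,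
        show z + τ - ((-(N + 1) : ℤ) : ℂ) * τ = z + ((N + 1 : ℕ) + 1) * τ by push_cast; ring,
        show z - ((-(N + 1) : ℤ) : ℂ) * τ = z + (N + 1) * τ by push_cast; ring,
        cotPi_neg, cotPi_neg]
      ring
  have h3 : ∀ a b : ℂ, Tendsto (fun N : ℕ => (a + (N + b) * τ).im) atTop atTop := by
    intro a b
    have := ((tendsto_natCast_atTop_atTop (R := ℝ)).atTop_mul_const hτ).atTop_add
      (tendsto_const_nhds (x := (a + b * τ).im))
    refine this.congr fun N => ?_
    simp [add_mul]
    ring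
  have h4 := (tendsto_cotPi (h3 z 1)).add (tendsto_cotPi (h3 (-z) (-1)))
  have h5 := tendsto_nhds_unique h1 (h4.congr fun N => by rw [← sub_eq_add_neg]; exact (h2 N).symm)
  linear_combination h5

theorem wSigma_eq_zero_iff {τ z : ℂ} (hτ : 0 < τ.im) :
    wSigma τ z = 0 ↔ ∃ q, z = latticePoint τ q := by
  refine ⟨fun h => ?_, fun ⟨q, hq⟩ => hq ▸ wSigma_latticePoint τ q⟩
  by_contra! hc
  exact wSigma_ne_zero hτ hc h

theorem wSigma_add_latticePoint {τ η : ℂ} (hτ : 0 < τ.im) (p : ℤ × ℤ)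
    (hη : ∀ z, (∀ q, z ≠ latticePoint τ q) → wZeta τ (z + latticePoint τ p) = wZeta τ z + η)
    (hp : ∀ q, -(latticePoint τ p / 2) ≠ latticePoint τ q) (z : ℂ) :
    wSigma τ (z + latticePoint τ p) =
      -Complex.exp (η * (z + latticePoint τ p / 2)) * wSigma τ z := by
  set ω := latticePoint τ p with hω
  by_cases hz : ∃ q, z = latticePoint τ q
  · obtain ⟨q, rfl⟩ := hz
    rw [hω, ← latticePoint_add, wSigma_latticePoint, wSigma_latticePoint, mul_zero]
  push Not at hz
  have hd := differentiable_wSigma hτ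
  have hopen : IsOpen {z | wSigma τ z ≠ 0} := isOpen_ne.preimage hd.continuous
  have hconn : IsPreconnected {z | wSigma τ z ≠ 0} := by
    have hc : (Set.range (latticePoint τ)).Countable := Set.countable_range _
    convert! (hc.isConnected_compl_of_one_lt_rank (by simp)).isPreconnected using 1
    ext w
    simp [wSigma_eq_zero_iff hτ, eq_comm]
  have hoff : ∀ w, wSigma τ w ≠ 0 → ∀ q, w ≠ latticePoint τ q := fun w hw q hq =>
    hw (hq ▸ wSigma_latticePoint τ q)
  have hderiv : ∀ w, wSigma τ w ≠ 0 →
      HasDerivAt (fun z => wSigma τ (z + ω) * Complex.exp (-(η * z)) / wSigma τ z) 0 w := by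
    intro w hw
    have h1 : HasDerivAt (fun z => wSigma τ (z + ω)) (deriv (wSigma τ) (w + ω)) w :=
      (hd (w + ω)).hasDerivAt.comp_add_const w ω
    have h2 : HasDerivAt (fun z => Complex.exp (-(η * z))) (Complex.exp (-(η * w)) * -(η * 1)) w :=
      ((hasDerivAt_id w).const_mul η).neg.cexp
    have h3 := hη w (hoff w hw)
    have h4 : wSigma τ (w + ω) ≠ 0 := wSigma_ne_zero hτ (ne_latticePoint_add (hoff w hw) p)
    rw [wZeta, wZeta, div_eq_iff h4] at h3
    convert! (h1.mul h2).div (hd w).hasDerivAt hw using 1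
    rw [h3, Pi.mul_apply]
    field_simp
    ring
  have hconst := hopen.is_const_of_deriv_eq_zero hconn
    (fun w hw => (hderiv w hw).differentiableAt.differentiableWithinAt)
    (fun w hw => (hderiv w hw).deriv) (wSigma_ne_zero hτ hz) (wSigma_ne_zero hτ hp)
  have h1 := wSigma_ne_zero hτ hp
  rw [show -(ω / 2) + ω = ω / 2 by ring, wSigma_neg] at hconst
  rw [wSigma_neg, neg_ne_zero] at h1
  have h2 := wSigma_ne_zero hτ hz
  rw [mul_comm (wSigma τ (ω / 2)), div_neg, mul_div_cancel_right₀ _ h1, div_eq_iff h2] at hconst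
  have h3 : Complex.exp (-(η * z)) * Complex.exp (η * z) = 1 := by
    rw [← Complex.exp_add]; simp
  rw [show η * (z + ω / 2) = -(η * -(ω / 2)) + η * z by ring, Complex.exp_add]
  linear_combination Complex.exp (η * z) * hconst - wSigma τ (z + ω) * h3

/-- The real-linear map interpolating the quasi-periods of the Weierstraß ζ-function. -/
noncomputable def quasiPeriod (τ z : ℂ) : ℂ :=
  (wEta1 τ - Real.pi / τ.im) * z + (Real.pi / τ.im) * (starRingEnd ℂ) z

theorem quasiPeriod_one (τ : ℂ) : quasiPeriod τ 1 = wEta1 τ := by simp [quasiPeriod]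

theorem quasiPeriod_tau {τ : ℂ} (hτ : 0 < τ.im) :
    quasiPeriod τ τ = wEta1 τ * τ - 2 * Real.pi * Complex.I := by
  have h : τ - (starRingEnd ℂ) τ = 2 * τ.im * Complex.I := by
    rw [Complex.sub_conj]; push_cast; ring
  have h1 : (τ.im : ℂ) ≠ 0 := mod_cast hτ.ne'
  have h2 : (Real.pi : ℂ) / τ.im * τ.im = Real.pi := div_mul_cancel₀ _ h1
  rw [quasiPeriod]
  linear_combination -((Real.pi : ℂ) / τ.im) * h - 2 * Complex.I * h2

theorem quasiPeriod_add (τ z w : ℂ) :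
    quasiPeriod τ (z + w) = quasiPeriod τ z + quasiPeriod τ w := by
  simp only [quasiPeriod, map_add]; ring

theorem quasiPeriod_sub (τ z w : ℂ) :
    quasiPeriod τ (z - w) = quasiPeriod τ z - quasiPeriod τ w := by
  simp only [quasiPeriod, map_sub]; ring

theorem re_mul_quasiPeriod_comm (τ z w : ℂ) :
    (z * quasiPeriod τ w).re = (w * quasiPeriod τ z).re := by
  have h1 : ((Real.pi : ℂ) / τ.im) = ((Real.pi / τ.im : ℝ) : ℂ) := by push_cast; rfl
  simp only [quasiPeriod, h1, mul_add, Complex.add_re, Complex.mul_re, Complex.mul_im,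
    Complex.sub_re, Complex.sub_im, Complex.ofReal_re, Complex.ofReal_im, Complex.conj_re,
    Complex.conj_im]
  ring

/-- The modulus of the σ-function, normalised to be doubly periodic. -/
noncomputable def periodicNormSigma (τ z : ℂ) : ℝ :=
  ‖wSigma τ z‖ * Real.exp (-((z * quasiPeriod τ z).re / 2))

theorem continuous_quasiPeriod (τ : ℂ) : Continuous (quasiPeriod τ) := by
  unfold quasiPeriod
  exact (continuous_const.mul continuous_id).add (continuous_const.mul Complex.continuous_conj)

theorem periodicNormSigma_add {τ ω z : ℂ}
    (h : wSigma τ (z + ω) = -Complex.exp (quasiPeriod τ ω * (z + ω / 2)) * wSigma τ z) :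
    periodicNormSigma τ (z + ω) = periodicNormSigma τ z := by
  rw [periodicNormSigma, periodicNormSigma, h, norm_mul, norm_neg, Complex.norm_exp, mul_right_comm,
    ← Real.exp_add, mul_comm]
  congr 2
  have h1 := re_mul_quasiPeriod_comm τ z ω
  rw [quasiPeriod_add]
  have h2 : ((z + ω) * (quasiPeriod τ z + quasiPeriod τ ω)).re = (z * quasiPeriod τ z).re +
    (z * quasiPeriod τ ω).re + (ω * quasiPeriod τ z).re + (ω * quasiPeriod τ ω).re := by
    rw [← Complex.add_re, ← Complex.add_re, ← Complex.add_re]; congr 1; ring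
  have h3 : (quasiPeriod τ ω * (z + ω / 2)).re = (z * quasiPeriod τ ω).re +
      (ω * quasiPeriod τ ω).re / 2 := by
    rw [← Complex.div_ofNat_re, ← Complex.add_re]; congr 1; ring
  rw [h2, h3]
  linarith

/-- The doubly periodic correction of the ζ-function, with value `0` at the lattice points. -/
noncomputable def periodicZeta (τ z : ℂ) : ℂ :=
  (deriv (wSigma τ) z - quasiPeriod τ z * wSigma τ z) / wSigma τ z

theorem periodicZeta_eq {τ z : ℂ} (hz : wSigma τ z ≠ 0) :
    periodicZeta τ z = wZeta τ z - quasiPeriod τ z := by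
  rw [periodicZeta, wZeta, sub_div, mul_div_cancel_right₀ _ hz]

theorem periodicZeta_add {τ z : ℂ} (hτ : 0 < τ.im) (p : ℤ × ℤ)
    (hp : ∀ z, (∀ q, z ≠ latticePoint τ q) →
      wZeta τ (z + latticePoint τ p) = wZeta τ z + quasiPeriod τ (latticePoint τ p)) :
    periodicZeta τ (z + latticePoint τ p) = periodicZeta τ z := by
  by_cases hz : ∃ q, z = latticePoint τ q
  · obtain ⟨q, rfl⟩ := hz
    rw [periodicZeta, periodicZeta, ← latticePoint_add, wSigma_latticePoint, wSigma_latticePoint,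
      _root_.div_zero, _root_.div_zero]
  push Not at hz
  rw [periodicZeta_eq (wSigma_ne_zero hτ hz),
    periodicZeta_eq (wSigma_ne_zero hτ (ne_latticePoint_add hz p)), hp z hz, quasiPeriod_add]
  ring

theorem neg_half_latticePoint_ne {τ : ℂ} (hτ : 0 < τ.im) {p : ℤ × ℤ}
    (hp : ∀ q : ℤ × ℤ, p ≠ 2 • q) (q : ℤ × ℤ) :
    -(latticePoint τ p / 2) ≠ latticePoint τ q := by
  intro h
  refine hp (-q) (latticePoint_injective hτ ?_)
  rw [two_smul, latticePoint_add, latticePoint_neg]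
  linear_combination -2 * h

theorem periodic_latticePoint {τ : ℂ} {α : Type*} {f : ℂ → α} (h1 : Function.Periodic f 1)
    (hτ : Function.Periodic f τ) (q : ℤ × ℤ) : Function.Periodic f (latticePoint τ q) := by
  have := (h1.int_mul q.1).add_period (hτ.int_mul q.2)
  rwa [mul_one] at this

theorem wZeta_add_one_zero {τ z : ℂ} (hτ : 0 < τ.im) (hz : ∀ q, z ≠ latticePoint τ q) :
    wZeta τ (z + latticePoint τ (1, 0)) =
      wZeta τ z + quasiPeriod τ (latticePoint τ (1, 0)) := by
  rw [latticePoint_one_zero, quasiPeriod_one, wZeta_add_one hτ hz]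

theorem wZeta_add_zero_one {τ z : ℂ} (hτ : 0 < τ.im) (hz : ∀ q, z ≠ latticePoint τ q) :
    wZeta τ (z + latticePoint τ (0, 1)) =
      wZeta τ z + quasiPeriod τ (latticePoint τ (0, 1)) := by
  rw [latticePoint_zero_one, quasiPeriod_tau hτ, wZeta_add_tau hτ hz]

theorem periodic_periodicZeta {τ : ℂ} (hτ : 0 < τ.im) (q : ℤ × ℤ) :
    Function.Periodic (periodicZeta τ) (latticePoint τ q) := by
  refine periodic_latticePoint (fun z => ?_) (fun z => ?_) q
  · simpa only [latticePoint_one_zero] using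
      periodicZeta_add (z := z) hτ (1, 0) fun z hz => wZeta_add_one_zero hτ hz
  · simpa only [latticePoint_zero_one] using
      periodicZeta_add (z := z) hτ (0, 1) fun z hz => wZeta_add_zero_one hτ hz

theorem periodic_periodicNormSigma {τ : ℂ} (hτ : 0 < τ.im) (q : ℤ × ℤ) :
    Function.Periodic (periodicNormSigma τ) (latticePoint τ q) := by
  refine periodic_latticePoint (fun z => ?_) (fun z => ?_) q
  · simpa only [latticePoint_one_zero] using periodicNormSigma_add
      (wSigma_add_latticePoint hτ (1, 0) (fun z hz => wZeta_add_one_zero hτ hz)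
        (neg_half_latticePoint_ne hτ fun q hq => by
          have := congrArg Prod.fst hq; simp at this; omega) z)
  · simpa only [latticePoint_zero_one] using periodicNormSigma_add
      (wSigma_add_latticePoint hτ (0, 1) (fun z hz => wZeta_add_zero_one hτ hz)
        (neg_half_latticePoint_ne hτ fun q hq => by
          have := congrArg Prod.snd hq; simp at this; omega) z)

/-- The Voronoi cell of the lattice point `0`. -/
def voronoiCell (τ : ℂ) : Set ℂ := {z | ∀ q, ‖z‖ ≤ ‖z - latticePoint τ q‖}

theorem isCompact_voronoiCell {τ : ℂ} (hτ : 0 < τ.im) : IsCompact (voronoiCell τ) := by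
  refine (isCompact_closedBall (0 : ℂ) (1 + ‖τ‖)).of_isClosed_subset ?_ fun z hz => ?_
  · have : voronoiCell τ = ⋂ q, {z | ‖z‖ ≤ ‖z - latticePoint τ q‖} := by
      ext z; simp [voronoiCell]
    rw [this]
    exact isClosed_iInter fun q => isClosed_le (by fun_prop) (by fun_prop)
  · obtain ⟨q, hq⟩ := exists_latticePoint_near hτ z
    rw [mem_closedBall_zero_iff]
    exact (hz q).trans (norm_sub_rev z _ ▸ hq)

theorem ne_latticePoint_of_mem_voronoiCell {τ z : ℂ} (hτ : 0 < τ.im) (hz : z ∈ voronoiCell τ)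
    {q : ℤ × ℤ} (hq : q ≠ 0) : z ≠ latticePoint τ q := by
  rintro rfl
  have := hz q
  rw [sub_self, norm_zero, norm_le_zero_iff, latticePoint_eq_zero_iff hτ] at this
  exact hq this

theorem exists_add_mem_voronoiCell {τ : ℂ} (hτ : 0 < τ.im) (z : ℂ) :
    ∃ q, z + latticePoint τ q ∈ voronoiCell τ := by
  obtain ⟨q, hq, hmin⟩ := Set.exists_min_image {q | ‖latticePoint τ q‖ ≤ 2 * ‖z‖}
    (fun q => ‖z - latticePoint τ q‖) (finite_norm_latticePoint_le hτ _)
    ⟨0, by simp [latticePoint_zero]⟩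
  refine ⟨-q, fun p => ?_⟩
  rw [latticePoint_neg, ← sub_eq_add_neg, sub_sub, ← latticePoint_add]
  by_cases hp : ‖latticePoint τ (q + p)‖ ≤ 2 * ‖z‖
  · exact hmin _ hp
  · have h0 := hmin 0 (by simp [latticePoint_zero])
    simp only [latticePoint_zero, sub_zero] at h0
    have h1 := norm_sub_norm_le (latticePoint τ (q + p)) z
    rw [norm_sub_rev] at h1
    push Not at hp
    linarith

theorem latticeProd_ne_zero_of_mem_voronoiCell {τ z : ℂ} (hτ : 0 < τ.im)
    (hz : z ∈ voronoiCell τ) : latticeProd τ z ≠ 0 :=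
  latticeProd_ne_zero hτ fun _ hq => ne_latticePoint_of_mem_voronoiCell hτ hz hq

theorem continuous_exp_neg_quasiPeriod (τ : ℂ) :
    Continuous fun z => Real.exp (-((z * quasiPeriod τ z).re / 2)) := by
  have := continuous_quasiPeriod τ
  fun_prop

theorem exists_periodicNormSigma_le {τ : ℂ} (hτ : 0 < τ.im) :
    ∃ C, ∀ z, periodicNormSigma τ z ≤ C := by
  have hc : Continuous (periodicNormSigma τ) :=
    (differentiable_wSigma hτ).continuous.norm.mul (continuous_exp_neg_quasiPeriod τ)
  obtain ⟨C, hC⟩ := (isCompact_voronoiCell hτ).bddAbove_image hc.continuousOn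
  refine ⟨C, fun z => ?_⟩
  obtain ⟨q, hq⟩ := exists_add_mem_voronoiCell hτ z
  rw [← periodic_periodicNormSigma hτ q z]
  exact hC (mem_image_of_mem _ hq)

theorem le_norm_add_latticePoint {τ z : ℂ} {δ : ℝ} (hz : z ∈ latticeFar τ δ) (q : ℤ × ℤ) :
    δ ≤ ‖z + latticePoint τ q‖ := by
  simpa [latticePoint_neg] using hz (-q)

theorem exists_le_periodicNormSigma {τ : ℂ} (hτ : 0 < τ.im) :
    ∃ c, 0 < c ∧ ∀ δ, ∀ z ∈ latticeFar τ δ, c * δ ≤ periodicNormSigma τ z := by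
  have hc : Continuous fun z =>
      ‖latticeProd τ z‖ * Real.exp (-((z * quasiPeriod τ z).re / 2)) :=
    (differentiable_latticeProd hτ).continuous.norm.mul (continuous_exp_neg_quasiPeriod τ)
  obtain ⟨z₀, hz₀, hmin⟩ := (isCompact_voronoiCell hτ).exists_isMinOn
    ⟨0, fun q => by simp⟩ hc.continuousOn
  refine ⟨‖latticeProd τ z₀‖ * Real.exp (-((z₀ * quasiPeriod τ z₀).re / 2)),
    mul_pos (norm_pos_iff.2 (latticeProd_ne_zero_of_mem_voronoiCell hτ hz₀))
    (Real.exp_pos _), fun δ z hz => ?_⟩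
  obtain ⟨q, hq⟩ := exists_add_mem_voronoiCell hτ z
  rw [← periodic_periodicNormSigma hτ q z, periodicNormSigma, wSigma_eq_mul_latticeProd, norm_mul,
    mul_assoc ‖z + latticePoint τ q‖, mul_comm _ δ]
  exact mul_le_mul (le_norm_add_latticePoint hz q) (hmin hq) (by positivity) (norm_nonneg _)

theorem exists_norm_periodicZeta_le {τ : ℂ} (hτ : 0 < τ.im) :
    ∃ C, 0 ≤ C ∧ ∀ δ, 0 < δ → ∀ z ∈ latticeFar τ δ, ‖periodicZeta τ z‖ ≤ 1 / δ + C := by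
  have hd := differentiable_latticeProd hτ
  have hc : ContinuousOn (fun z => deriv (latticeProd τ) z / latticeProd τ z - quasiPeriod τ z)
      (voronoiCell τ) :=
    (hd.contDiff.continuous_deriv_one.continuousOn.div hd.continuous.continuousOn
      fun z hz => latticeProd_ne_zero_of_mem_voronoiCell hτ hz).sub
      (continuous_quasiPeriod τ).continuousOn
  obtain ⟨C, hC⟩ := (isCompact_voronoiCell hτ).exists_bound_of_continuousOn hc
  refine ⟨C, (norm_nonneg _).trans (hC 0 fun q => by simp), fun δ hδ z hz => ?_⟩
  obtain ⟨q, hq⟩ := exists_add_mem_voronoiCell hτ z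
  have h1 := le_norm_add_latticePoint hz q
  have h2 : ∀ p, z + latticePoint τ q ≠ latticePoint τ p := by
    refine ne_latticePoint_add (fun p hp => ?_) q
    have := hz p
    rw [hp, sub_self, norm_zero] at this
    linarith
  rw [← periodic_periodicZeta hτ q z, periodicZeta_eq (wSigma_ne_zero hτ h2),
    wZeta_eq_add_logDeriv hτ h2, add_sub_assoc]
  refine (norm_add_le _ _).trans (add_le_add ?_ (hC _ hq))
  rw [norm_div, norm_one]
  gcongr

theorem norm_quasiPeriod_le {τ : ℂ} (hτ : 0 < τ.im) (z : ℂ) :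
    ‖quasiPeriod τ z‖ ≤ (‖wEta1 τ - Real.pi / τ.im‖ + Real.pi / τ.im) * ‖z‖ := by
  have h : ‖((Real.pi : ℂ) / τ.im)‖ = Real.pi / τ.im := by
    rw [norm_div, Complex.norm_real, Complex.norm_real, Real.norm_of_nonneg Real.pi_pos.le,
      Real.norm_of_nonneg hτ.le]
  refine (norm_add_le _ _).trans ?_
  rw [norm_mul, norm_mul, Complex.norm_conj, h, add_mul]

/-- If `‖A‖ ≤ B`, the real-linear map `z ↦ A z + B conj z` is non-degenerate in one direction. -/
theorem exists_direction (A : ℂ) {B : ℝ} (hB : ‖A‖ ≤ B) : ∃ u : ℂ, ‖u‖ = 1 ∧ ∀ z : ℂ,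
    B * |(u * z).re| ≤ ‖A * z + B * (starRingEnd ℂ) z‖ ∧
      B * (u * z).re ^ 2 ≤ (z * (A * z + B * (starRingEnd ℂ) z)).re := by
  set u := Complex.exp ((A.arg / 2 : ℝ) * Complex.I)
  have hu : ‖u‖ = 1 := Complex.norm_exp_ofReal_mul_I _
  have hA : A = ‖A‖ * u ^ 2 := by
    rw [← Complex.exp_nat_mul]
    conv_lhs => rw [← Complex.norm_mul_exp_arg_mul_I A]
    push_cast
    ring_nf
  have huu : u * (starRingEnd ℂ) u = 1 := by
    rw [Complex.mul_conj, Complex.normSq_eq_norm_sq, hu]; simp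
  refine ⟨u, hu, fun z => ?_⟩
  set w := u * z
  have hw : A * z + B * (starRingEnd ℂ) z = u * (‖A‖ * w + B * (starRingEnd ℂ) w) := by
    conv_lhs => rw [hA]
    simp only [w, map_mul]
    linear_combination -(B * (starRingEnd ℂ) z) * huu
  have hre : (‖A‖ * w + B * (starRingEnd ℂ) w).re = (‖A‖ + B) * w.re := by
    simp; ring
  constructor
  · rw [hw, norm_mul, hu, one_mul]
    refine le_trans ?_ (Complex.abs_re_le_norm _)
    have h0 := norm_nonneg A
    rw [hre, abs_mul, abs_of_nonneg (show 0 ≤ ‖A‖ + B by linarith)]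
    gcongr
    linarith
  · rw [hw, ← mul_assoc, mul_comm z u]
    change B * w.re ^ 2 ≤ (w * (‖A‖ * w + B * (starRingEnd ℂ) w)).re
    simp only [Complex.mul_re, Complex.add_re, Complex.add_im, Complex.mul_im, Complex.ofReal_re,
      Complex.ofReal_im, Complex.conj_re, Complex.conj_im]
    nlinarith [mul_nonneg (norm_nonneg A) (sq_nonneg w.re),
      mul_nonneg (sub_nonneg.2 hB) (sq_nonneg w.im)]

theorem norm_sub_le_of_le_re_inv {a : ℂ} {B : ℝ} (hB : 0 < B) (ha : a ≠ 0)
    (h : (2 * B)⁻¹ ≤ (a⁻¹).re) : ‖a - B‖ ≤ B := by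
  have h1 : 0 < Complex.normSq a := Complex.normSq_pos.2 ha
  rw [Complex.inv_re, le_div_iff₀ h1, inv_mul_le_iff₀ (by positivity)] at h
  refine le_of_sq_le_sq ?_ hB.le
  rw [← Complex.normSq_eq_norm_sq]
  rw [Complex.normSq_apply] at h ⊢
  simp
  nlinarith

theorem exists_latticeGrowth_wSigma {τ : ℂ} (hτ : 0 < τ.im) (hη : wEta1 τ ≠ 0)
    (hcond : τ.im / (2 * Real.pi) ≤ ((wEta1 τ)⁻¹).re) :
    ∃ u C c, LatticeGrowth τ u (wSigma τ) C c := by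
  obtain ⟨C₁, hC₁⟩ := exists_periodicNormSigma_le hτ
  obtain ⟨c₁, hc₁, hc₁'⟩ := exists_le_periodicNormSigma hτ
  obtain ⟨C₂, hC₂, hC₂'⟩ := exists_norm_periodicZeta_le hτ
  have hB : 0 < Real.pi / τ.im := div_pos Real.pi_pos hτ
  have hA : ‖wEta1 τ - (Real.pi / τ.im : ℝ)‖ ≤ Real.pi / τ.im := by
    refine norm_sub_le_of_le_re_inv hB hη (le_trans (le_of_eq ?_) hcond)
    field_simp
  obtain ⟨u, hu, hu'⟩ := exists_direction _ hA
  have hq : ∀ z, quasiPeriod τ z = (wEta1 τ - (Real.pi / τ.im : ℝ)) * z +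
      (Real.pi / τ.im : ℝ) * (starRingEnd ℂ) z := fun z => by
    rw [quasiPeriod]; push_cast; rfl
  simp only [← hq] at hu'
  have hq' := norm_quasiPeriod_le hτ
  set B := Real.pi / τ.im
  set D := ‖wEta1 τ - Real.pi / τ.im‖ + B
  have hD : 0 ≤ D := by positivity
  have hC₁0 : 0 ≤ C₁ := (mul_nonneg (norm_nonneg _) (Real.exp_pos _).le).trans (hC₁ 0)
  have hσ : ∀ z, ‖wSigma τ z‖ =
      periodicNormSigma τ z * Real.exp ((z * quasiPeriod τ z).re / 2) := fun z => by
    rw [periodicNormSigma, mul_assoc, ← Real.exp_add, neg_add_cancel, Real.exp_zero, mul_one]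
  have hne : ∀ δ, 0 < δ → ∀ z ∈ latticeFar τ δ, wSigma τ z ≠ 0 := fun δ hδ z hz =>
    wSigma_ne_zero hτ fun p hp => by
      have := hz p
      rw [hp, sub_self, norm_zero] at this
      linarith
  have hζ : ∀ δ, 0 < δ → δ ≤ 1 → ∀ z ∈ latticeFar τ δ,
      ‖wZeta τ z - quasiPeriod τ z‖ ≤ (1 + C₂) / δ := fun δ hδ hδ1 z hz => by
    rw [← periodicZeta_eq (hne δ hδ z hz)]
    refine (hC₂' δ hδ z hz).trans ?_
    rw [add_div]
    gcongr
    exact le_div_self hC₂ hδ hδ1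
  refine ⟨u, 1 + C₁ + D + 2 * (1 + C₂), min c₁ (B / 2), ?_, ?_, hu, differentiable_wSigma hτ,
    wSigma_latticePoint τ, fun z => ?_, fun δ hδ hδ1 z hz => ?_, fun δ hδ hδ1 z hz => ?_,
    fun δ hδ hδ1 z hz w hw hzw => ?_⟩
  · linarith
  · exact lt_min hc₁ (half_pos hB)
  · have h1 : (z * quasiPeriod τ z).re ≤ D * ‖z‖ ^ 2 := by
      refine (Complex.re_le_norm _).trans ?_
      rw [norm_mul]
      nlinarith [hq' z, norm_nonneg z]
    have h2 : C₁ ≤ Real.exp C₁ := by linarith [Real.add_one_le_exp C₁]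
    rw [hσ]
    calc _ ≤ Real.exp C₁ * Real.exp ((z * quasiPeriod τ z).re / 2) := by
          gcongr
          exact (hC₁ z).trans h2
      _ ≤ _ := by
          rw [← Real.exp_add, Real.exp_le_exp]
          nlinarith [mul_nonneg hD (sq_nonneg ‖z‖), mul_nonneg hC₁0 (sq_nonneg ‖z‖),
            mul_nonneg hC₂ (sq_nonneg ‖z‖), sq_nonneg ‖z‖]
  · rw [hσ]
    have h1 := (hu' z).2
    have h2 : min c₁ (B / 2) * (u * z).re ^ 2 ≤ B / 2 * (u * z).re ^ 2 := by
      gcongr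
      exact min_le_right _ _
    refine mul_le_mul (le_trans ?_ (hc₁' δ z hz)) (Real.exp_le_exp.2 (by linarith))
      (Real.exp_pos _).le (mul_nonneg (norm_nonneg _) (Real.exp_pos _).le)
    gcongr
    exact min_le_left _ _
  · have h1 := (hu' z).1
    have h2 := hζ δ hδ hδ1 z hz
    have h3 : min c₁ (B / 2) * |(u * z).re| ≤ B * |(u * z).re| := by
      gcongr
      exact (min_le_right _ _).trans (half_le_self hB.le)
    have h4 : ‖quasiPeriod τ z‖ ≤ ‖wZeta τ z‖ + ‖wZeta τ z - quasiPeriod τ z‖ := by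
      have := norm_sub_le (wZeta τ z) (wZeta τ z - quasiPeriod τ z)
      rwa [_root_.sub_sub_cancel] at this
    have h5 : (1 + C₂) / δ ≤ (1 + C₁ + D + 2 * (1 + C₂)) / δ := by
      exact div_le_div_of_nonneg_right (by linarith) hδ.le
    rw [← wZeta]
    linarith
  · have h1 := hζ δ hδ hδ1 z hz
    have h2 := hζ δ hδ hδ1 w hw
    have h3 : ‖quasiPeriod τ (z - w)‖ ≤ D / δ :=
      ((hq' _).trans (mul_le_of_le_one_right hD hzw)).trans (le_div_self hD hδ hδ1)
    have h4 : wZeta τ z - wZeta τ w = (wZeta τ z - quasiPeriod τ z) -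
        (wZeta τ w - quasiPeriod τ w) + quasiPeriod τ (z - w) := by
      rw [quasiPeriod_sub]; ring
    rw [← wZeta, ← wZeta, h4]
    refine (norm_add_le _ _).trans ((add_le_add (norm_sub_le _ _) h3).trans ?_)
    have h5 : (1 + C₁) / δ ≥ 0 := by positivity
    have h6 : (1 + C₁ + D + 2 * (1 + C₂)) / δ =
        (1 + C₁) / δ + D / δ + 2 * ((1 + C₂) / δ) := by ring
    linarith

theorem weierstrass_sigma_julia_positive_measure
    (τ : ℂ) (hτ : 0 < τ.im) (hη : wEta1 τ ≠ 0)
    (hcond : τ.im / (2 * Real.pi) ≤ ((wEta1 τ)⁻¹).re) :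
    0 < volume (juliaSet (wSigma τ) ∩ fastEscapingSet (wSigma τ)) := by
  obtain ⟨u, C, c, h⟩ := exists_latticeGrowth_wSigma hτ hη hcond
  exact h.volume_pos hτ (wSigma_ne_zero hτ (neg_half_ne_latticePoint hτ))
end

section
/- Let β > α > 0 and for γ > 0 define E_γ : [0,∞) → [0,∞) by E_γ(x) = exp(x^γ). Then there exists x₀ > 0 such that E_α^k(x) ≥ E_β^{k−2}(x) for all integers k ≥ 4 and all x ≥ x₀, where E_γ^k denotes the k-th iterate of E_γ. -/
open Filter in
/-- For large `x`, the function `exp (x ^ α)` dominates every fixed power of `x`. -/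
theorem eventually_rpow_le_exp_rpow {α : ℝ} (hα : 0 < α) (M : ℝ) :
    ∀ᶠ x : ℝ in atTop, x ^ M ≤ Real.exp (x ^ α) := by
  have h := (isLittleO_rpow_exp_atTop (M / α)).bound one_pos
  filter_upwards [(tendsto_rpow_atTop hα).eventually h, eventually_ge_atTop 0] with x hx hx0
  rw [← Real.rpow_mul hx0, mul_div_cancel₀ M hα.ne', one_mul, Real.norm_of_nonneg (by positivity),
    Real.norm_of_nonneg (Real.exp_pos _).le] at hx
  exact hx

/-- Domination by the power `2 * β / α` is preserved when `E_β` and `E_α` are applied. -/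
theorem exp_rpow_rpow_le_exp_rpow {α β a b : ℝ} (hα : 0 < α) (hb : 0 ≤ b)
    (hbM : 2 * β / α ≤ b ^ β) (h : b ^ (2 * β / α) ≤ a) :
    Real.exp (b ^ β) ^ (2 * β / α) ≤ Real.exp (a ^ α) := by
  rw [← Real.exp_mul, Real.exp_le_exp]
  calc b ^ β * (2 * β / α) ≤ b ^ β * b ^ β := by gcongr
    _ = (b ^ (2 * β / α)) ^ α := by
      rw [← Real.rpow_mul hb, div_mul_cancel₀ _ hα.ne', mul_comm 2 β, Real.rpow_mul hb,
        Real.rpow_two, sq]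
    _ ≤ a ^ α := by gcongr

theorem iterated_exp_power_comparison (α β : ℝ) (hα : 0 < α) (hαβ : α < β) :
    ∃ x₀ : ℝ, 0 < x₀ ∧ ∀ k : ℕ, 4 ≤ k → ∀ x : ℝ, x₀ ≤ x →
      (fun y : ℝ => Real.exp (y ^ β))^[k - 2] x ≤ (fun y : ℝ => Real.exp (y ^ α))^[k] x := by
  have hβ : 0 < β := hα.trans hαβ
  have hM : 1 ≤ 2 * β / α := by rw [le_div_iff₀ hα]; linarith
  obtain ⟨x₀, hx₀⟩ := Filter.eventually_atTop.1
    ((eventually_rpow_le_exp_rpow hα (2 * β / α)).and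
      (((tendsto_rpow_atTop hβ).eventually_ge_atTop (2 * β / α)).and
        (Filter.eventually_ge_atTop 1)))
  refine ⟨max x₀ 1, by positivity, fun k hk x hx => ?_⟩
  replace hx : x₀ ≤ x := (le_max_left _ _).trans hx
  have le_pow {y : ℝ} (hy : x₀ ≤ y) : y ≤ y ^ (2 * β / α) :=
    Real.self_le_rpow_of_one_le (hx₀ y hy).2.2 hM
  have le_exp {y : ℝ} (hy : x₀ ≤ y) : y ≤ Real.exp (y ^ α) := (le_pow hy).trans (hx₀ y hy).1
  obtain ⟨n, rfl⟩ := Nat.exists_eq_add_of_le' (show 2 ≤ k by lia)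
  rw [Nat.add_sub_cancel]
  suffices H : x₀ ≤ (fun y : ℝ => Real.exp (y ^ β))^[n] x ∧
      ((fun y : ℝ => Real.exp (y ^ β))^[n] x) ^ (2 * β / α) ≤
        (fun y : ℝ => Real.exp (y ^ α))^[n + 2] x from (le_pow H.1).trans H.2
  clear hk
  induction n with
  | zero => exact ⟨hx, (hx₀ x hx).1.trans (le_exp (hx.trans (le_exp hx)))⟩
  | succ n ih =>
    rw [show n + 1 + 2 = (n + 2) + 1 by rfl, Function.iterate_succ_apply',
      Function.iterate_succ_apply' _ (n + 2)]
    obtain ⟨hb, hab⟩ := ih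
    generalize (fun y : ℝ => Real.exp (y ^ β))^[n] x = b at hb hab ⊢
    obtain ⟨-, hbM, hb1⟩ := hx₀ b hb
    refine ⟨(hb.trans (le_exp hb)).trans ?_,
      exp_rpow_rpow_le_exp_rpow hα (zero_le_one.trans hb1) hbM hab⟩
    exact Real.exp_le_exp.2 (Real.rpow_le_rpow_of_exponent_le hb1 hαβ.le)
end
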